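/- arXiv:1202.1598 — 9 statements merged into one kernel-verified Lean document; each statement's English description precedes it below -/
import Mathlib

section
/- For any bipartite quantum state ρ on ℂ^M ⊗ ℂ^N and any unitaries V_A on ℂ^M and V_B on ℂ^N, one has D((V_A ⊗ V_B) ρ (V_A ⊗ V_B)†) = D(ρ); that is, the measure D is invariant under local unitary operations. -/
open Matrix Kronecker BigOperators ComplexOrder

noncomputable section

/-- Frobenius (Hilbert–Schmidt) norm of a square complex matrix. -/
def frob {n : Type*} [Fintype n] (A : Matrix n n ℂ) : ℝ :=
  Real.sqrt (Matrix.trace (Aᴴ * A)).re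

/-- Conjugation of a bipartite matrix by `U ⊗ I`. -/
def conjA {M N : ℕ} (U : Matrix (Fin M) (Fin M) ℂ)
    (ρ : Matrix (Fin M × Fin N) (Fin M × Fin N) ℂ) :
    Matrix (Fin M × Fin N) (Fin M × Fin N) ℂ :=
  (U ⊗ₖ (1 : Matrix (Fin N) (Fin N) ℂ)) * ρ * (U ⊗ₖ (1 : Matrix (Fin N) (Fin N) ℂ))ᴴ

/-- The quantity `D(ρ,U) = (1/√2)·‖ρ − (U⊗I) ρ (U⊗I)†‖_F`. -/
def DU {M N : ℕ} (ρ : Matrix (Fin M × Fin N) (Fin M × Fin N) ℂ)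
    (U : Matrix (Fin M) (Fin M) ℂ) : ℝ :=
  (1 / Real.sqrt 2) * frob (ρ - conjA U ρ)

/-- A Root-of-Unity (RU) unitary: a unitary whose eigenvalues, with multiplicity,
are exactly the `M` distinct `M`-th roots of unity. -/
def IsRU {M : ℕ} (U : Matrix (Fin M) (Fin M) ℂ) : Prop :=
  ∃ V ∈ Matrix.unitaryGroup (Fin M) ℂ,
    U = V * Matrix.diagonal (fun k : Fin M =>
      Complex.exp (2 * Real.pi * Complex.I * (((k : ℕ) : ℂ) + 1) / (M : ℂ))) * Vᴴ

/-- The measure `D(ρ)`: infimum of `D(ρ,U)` over RU unitaries `U`. -/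
def Dm {M N : ℕ} (ρ : Matrix (Fin M × Fin N) (Fin M × Fin N) ℂ) : ℝ :=
  sInf {d : ℝ | ∃ U, IsRU U ∧ d = DU ρ U}

/-- A bipartite quantum state: positive semidefinite with unit trace. -/
def IsState {M N : ℕ} (ρ : Matrix (Fin M × Fin N) (Fin M × Fin N) ℂ) : Prop :=
  ρ.PosSemidef ∧ ρ.trace = 1

/-- Partial trace over the second tensor factor. -/
def traceB {M N : ℕ} (ρ : Matrix (Fin M × Fin N) (Fin M × Fin N) ℂ) :
    Matrix (Fin M) (Fin M) ℂ :=
  Matrix.of fun p q => ∑ j : Fin N, ρ (p, j) (q, j)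

/-- Rank-one outer product `|v⟩⟨v|`. -/
def outer {α : Type*} (v : α → ℂ) : Matrix α α ℂ :=
  Matrix.of fun i j => v i * (starRingEnd ℂ) (v j)

/-- The Pauli matrices. -/
def pauli : Fin 3 → Matrix (Fin 2) (Fin 2) ℂ :=
  ![!![0, 1; 1, 0], !![0, -Complex.I; Complex.I, 0], !![1, 0; 0, -1]]


theorem isRU_conj {M : ℕ} {U V : Matrix (Fin M) (Fin M) ℂ} (hU : IsRU U)
    (hV : V ∈ Matrix.unitaryGroup (Fin M) ℂ) : IsRU (V * U * Vᴴ) := by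
  obtain ⟨W, hW, rfl⟩ := hU
  exact ⟨V * W, mul_mem hV hW, by simp only [conjTranspose_mul, Matrix.mul_assoc]⟩

theorem frob_unitary_conj {n : Type*} [Fintype n] [DecidableEq n] {W : Matrix n n ℂ}
    (hW : Wᴴ * W = 1) (A : Matrix n n ℂ) : frob (W * A * Wᴴ) = frob A := by
  have h : (W * A * Wᴴ)ᴴ * (W * A * Wᴴ) = W * (Aᴴ * A) * Wᴴ := by
    calc (W * A * Wᴴ)ᴴ * (W * A * Wᴴ) = W * Aᴴ * (Wᴴ * W) * A * Wᴴ := by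
          simp only [conjTranspose_mul, conjTranspose_conjTranspose, Matrix.mul_assoc]
      _ = W * (Aᴴ * A) * Wᴴ := by rw [hW]; simp only [Matrix.mul_one, Matrix.mul_assoc]
  unfold frob
  rw [h, Matrix.trace_mul_comm, ← Matrix.mul_assoc, hW, Matrix.one_mul]

theorem kronecker_conjTranspose_mul_self {m n : Type*} [Fintype m] [DecidableEq m]
    [Fintype n] [DecidableEq n] {A : Matrix m m ℂ} {B : Matrix n n ℂ}
    (hA : Aᴴ * A = 1) (hB : Bᴴ * B = 1) : (A ⊗ₖ B)ᴴ * (A ⊗ₖ B) = 1 := by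
  rw [conjTranspose_kronecker, ← mul_kronecker_mul, hA, hB, one_kronecker_one]

theorem conjA_local_unitary {M N : ℕ} (ρ : Matrix (Fin M × Fin N) (Fin M × Fin N) ℂ)
    (U VA : Matrix (Fin M) (Fin M) ℂ) (VB : Matrix (Fin N) (Fin N) ℂ) (hA : VAᴴ * VA = 1) :
    conjA (VA * U * VAᴴ) ((VA ⊗ₖ VB) * ρ * (VA ⊗ₖ VB)ᴴ) =
      (VA ⊗ₖ VB) * conjA U ρ * (VA ⊗ₖ VB)ᴴ := by
  have h : ((VA * U * VAᴴ) ⊗ₖ (1 : Matrix (Fin N) (Fin N) ℂ)) * (VA ⊗ₖ VB) =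
      (VA ⊗ₖ VB) * (U ⊗ₖ (1 : Matrix (Fin N) (Fin N) ℂ)) := by
    rw [← mul_kronecker_mul, ← mul_kronecker_mul, Matrix.mul_assoc, hA, Matrix.mul_one,
      Matrix.one_mul, Matrix.mul_one]
  calc conjA (VA * U * VAᴴ) ((VA ⊗ₖ VB) * ρ * (VA ⊗ₖ VB)ᴴ)
      = (((VA * U * VAᴴ) ⊗ₖ (1 : Matrix (Fin N) (Fin N) ℂ)) * (VA ⊗ₖ VB)) * ρ *
        (((VA * U * VAᴴ) ⊗ₖ (1 : Matrix (Fin N) (Fin N) ℂ)) * (VA ⊗ₖ VB))ᴴ := by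
        rw [conjA, conjTranspose_mul (_ ⊗ₖ _) (VA ⊗ₖ VB)]
        simp only [Matrix.mul_assoc]
    _ = (VA ⊗ₖ VB) * conjA U ρ * (VA ⊗ₖ VB)ᴴ := by
        rw [h, conjA, conjTranspose_mul (VA ⊗ₖ VB)]
        simp only [Matrix.mul_assoc]

theorem DU_local_unitary {M N : ℕ} (ρ : Matrix (Fin M × Fin N) (Fin M × Fin N) ℂ)
    (U VA : Matrix (Fin M) (Fin M) ℂ) (VB : Matrix (Fin N) (Fin N) ℂ)
    (hA : VAᴴ * VA = 1) (hB : VBᴴ * VB = 1) :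
    DU ((VA ⊗ₖ VB) * ρ * (VA ⊗ₖ VB)ᴴ) (VA * U * VAᴴ) = DU ρ U := by
  rw [DU, DU, conjA_local_unitary ρ U VA VB hA, ← Matrix.sub_mul, ← Matrix.mul_sub,
    frob_unitary_conj (kronecker_conjTranspose_mul_self hA hB)]

/-- `D` is invariant under local unitary operations: for any bipartite
quantum state `ρ` on `ℂ^M ⊗ ℂ^N` and unitaries `V_A`, `V_B` on the two factors,
`D((V_A ⊗ V_B) ρ (V_A ⊗ V_B)†) = D(ρ)`. -/
theorem D_local_unitary_invariant {M N : ℕ}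
    (ρ : Matrix (Fin M × Fin N) (Fin M × Fin N) ℂ) (hρ : IsState ρ)
    (VA : Matrix (Fin M) (Fin M) ℂ) (VB : Matrix (Fin N) (Fin N) ℂ)
    (hVA : VA ∈ Matrix.unitaryGroup (Fin M) ℂ)
    (hVB : VB ∈ Matrix.unitaryGroup (Fin N) ℂ) :
    Dm ((VA ⊗ₖ VB) * ρ * (VA ⊗ₖ VB)ᴴ) = Dm ρ := by
  have hA : VAᴴ * VA = 1 := Matrix.mem_unitaryGroup_iff'.mp hVA
  have hA' : VA * VAᴴ = 1 := Matrix.mem_unitaryGroup_iff.mp hVA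
  have hB : VBᴴ * VB = 1 := Matrix.mem_unitaryGroup_iff'.mp hVB
  unfold Dm
  congr 1
  ext d
  constructor
  · rintro ⟨U, hU, rfl⟩
    refine ⟨VAᴴ * U * VA, ?_, ?_⟩
    · simpa only [star_eq_conjTranspose, conjTranspose_conjTranspose] using
        isRU_conj hU (Unitary.star_mem hVA)
    · have h : VA * (VAᴴ * U * VA) * VAᴴ = U := by
        calc VA * (VAᴴ * U * VA) * VAᴴ = (VA * VAᴴ) * U * (VA * VAᴴ) := by
              simp only [Matrix.mul_assoc]
          _ = U := by rw [hA', Matrix.one_mul, Matrix.mul_one]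
      rw [← DU_local_unitary ρ (VAᴴ * U * VA) VA VB hA hB, h]
  · rintro ⟨U, hU, rfl⟩
    exact ⟨VA * U * VAᴴ, isRU_conj hU hVA, (DU_local_unitary ρ U VA VB hA hB).symm⟩

end
end

section
/- For any bipartite quantum state ρ on ℂ² ⊗ ℂ^N, one has D(ρ) ≤ 2·√(λ_min(Tr_B(ρ²))), where Tr_B(ρ²) is the partial trace over the second factor of ρ² (a positive semidefinite 2×2 matrix) and λ_min denotes its smallest eigenvalue. -/
open Matrix Kronecker BigOperators ComplexOrder

noncomputable section

lemma isHermitian_sq {n : Type*} [Fintype n] {A : Matrix n n ℂ} (hA : A.IsHermitian) :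
    (A * A).IsHermitian := by
  unfold Matrix.IsHermitian at *
  rw [Matrix.conjTranspose_mul, hA]

lemma traceB_isHermitian {M N : ℕ} {A : Matrix (Fin M × Fin N) (Fin M × Fin N) ℂ}
    (hA : A.IsHermitian) : (traceB A).IsHermitian := by
  ext p q
  simp only [traceB, Matrix.conjTranspose_apply, Matrix.of_apply, star_sum]
  exact Finset.sum_congr rfl fun j _ => hA.apply (p, j) (q, j)

lemma conjA_mul {M N : ℕ} (U V : Matrix (Fin M) (Fin M) ℂ)
    (ρ : Matrix (Fin M × Fin N) (Fin M × Fin N) ℂ) :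
    conjA (U * V) ρ = conjA U (conjA V ρ) := by
  have h : (U * V) ⊗ₖ (1 : Matrix (Fin N) (Fin N) ℂ) = (U ⊗ₖ 1) * (V ⊗ₖ 1) := by
    rw [← mul_kronecker_mul, one_mul]
  simp only [conjA, h, conjTranspose_mul, Matrix.mul_assoc]

lemma conjA_one {M N : ℕ} (ρ : Matrix (Fin M × Fin N) (Fin M × Fin N) ℂ) :
    conjA 1 ρ = ρ := by
  simp [conjA]

lemma conjA_sub {M N : ℕ} (U : Matrix (Fin M) (Fin M) ℂ)
    (ρ σ : Matrix (Fin M × Fin N) (Fin M × Fin N) ℂ) :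
    conjA U (ρ - σ) = conjA U ρ - conjA U σ := by
  simp only [conjA, Matrix.mul_sub, Matrix.sub_mul]

lemma conjTranspose_kronecker_one_mul_self {M N : ℕ} {U : Matrix (Fin M) (Fin M) ℂ}
    (hU : Uᴴ * U = 1) :
    (U ⊗ₖ (1 : Matrix (Fin N) (Fin N) ℂ))ᴴ * (U ⊗ₖ (1 : Matrix (Fin N) (Fin N) ℂ)) = 1 := by
  rw [conjTranspose_kronecker, ← mul_kronecker_mul, hU, conjTranspose_one, one_mul,
    one_kronecker_one]

lemma conjA_mul_conjA {M N : ℕ} {U : Matrix (Fin M) (Fin M) ℂ} (hU : Uᴴ * U = 1)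
    (ρ σ : Matrix (Fin M × Fin N) (Fin M × Fin N) ℂ) :
    conjA U ρ * conjA U σ = conjA U (ρ * σ) := by
  have h := conjTranspose_kronecker_one_mul_self (N := N) hU
  unfold conjA
  generalize U ⊗ₖ (1 : Matrix (Fin N) (Fin N) ℂ) = W at h
  calc W * ρ * Wᴴ * (W * σ * Wᴴ) = W * ρ * (Wᴴ * W) * σ * Wᴴ := by
        simp only [Matrix.mul_assoc]
    _ = W * (ρ * σ) * Wᴴ := by rw [h, Matrix.mul_one]; simp only [Matrix.mul_assoc]

lemma conjTranspose_conjA {M N : ℕ} (U : Matrix (Fin M) (Fin M) ℂ)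
    (ρ : Matrix (Fin M × Fin N) (Fin M × Fin N) ℂ) :
    (conjA U ρ)ᴴ = conjA U ρᴴ := by
  simp only [conjA, conjTranspose_mul, conjTranspose_conjTranspose, Matrix.mul_assoc]

lemma trace_conjA {M N : ℕ} {U : Matrix (Fin M) (Fin M) ℂ} (hU : Uᴴ * U = 1)
    (ρ : Matrix (Fin M × Fin N) (Fin M × Fin N) ℂ) :
    (conjA U ρ).trace = ρ.trace := by
  rw [conjA, trace_mul_comm, ← Matrix.mul_assoc, conjTranspose_kronecker_one_mul_self hU,
    Matrix.one_mul]

lemma frob_conjA {M N : ℕ} {U : Matrix (Fin M) (Fin M) ℂ} (hU : Uᴴ * U = 1)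
    (ρ : Matrix (Fin M × Fin N) (Fin M × Fin N) ℂ) :
    frob (conjA U ρ) = frob ρ := by
  rw [frob, conjTranspose_conjA, conjA_mul_conjA hU, trace_conjA hU, frob]

lemma conjA_apply {M N : ℕ} (U : Matrix (Fin M) (Fin M) ℂ)
    (ρ : Matrix (Fin M × Fin N) (Fin M × Fin N) ℂ) (p q : Fin M) (j k : Fin N) :
    conjA U ρ (p, j) (q, k) = ∑ b, (∑ a, U p a * ρ (a, j) (b, k)) * star (U q b) := by
  simp [conjA, Matrix.mul_apply, Fintype.sum_prod_type, Matrix.one_apply,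
    apply_ite (starRingEnd ℂ)]

lemma traceB_conjA {M N : ℕ} (U : Matrix (Fin M) (Fin M) ℂ)
    (ρ : Matrix (Fin M × Fin N) (Fin M × Fin N) ℂ) :
    traceB (conjA U ρ) = U * traceB ρ * Uᴴ := by
  ext p q
  simp only [traceB, Matrix.of_apply, conjA_apply, Matrix.mul_apply, conjTranspose_apply,
    Finset.mul_sum]
  rw [Finset.sum_comm]
  refine Finset.sum_congr rfl fun b _ => ?_
  rw [← Finset.sum_mul, Finset.sum_comm]

lemma frob_eq_sqrt_sum {n : Type*} [Fintype n] (A : Matrix n n ℂ) :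
    frob A = Real.sqrt (∑ x, ∑ y, ‖A y x‖ ^ 2) := by
  rw [frob]
  congr 1
  simp only [Matrix.trace, Matrix.diag_apply, Matrix.mul_apply, conjTranspose_apply,
    Complex.re_sum, ← Complex.normSq_eq_norm_sq]
  refine Finset.sum_congr rfl fun x _ => Finset.sum_congr rfl fun y _ => ?_
  simp [Complex.normSq_apply]

lemma traceB_sq_apply_self_re {M N : ℕ} {ρ : Matrix (Fin M × Fin N) (Fin M × Fin N) ℂ}
    (hρ : ρ.IsHermitian) (p : Fin M) :
    (traceB (ρ * ρ) p p).re = ∑ j, ∑ q, ∑ k, ‖ρ (p, j) (q, k)‖ ^ 2 := by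
  simp only [traceB, Matrix.of_apply, Matrix.mul_apply, Complex.re_sum, Fintype.sum_prod_type,
    ← Complex.normSq_eq_norm_sq]
  refine Finset.sum_congr rfl fun j _ => Finset.sum_congr rfl fun q _ =>
    Finset.sum_congr rfl fun k _ => ?_
  rw [← hρ.apply (q, k) (p, j)]
  simp [Complex.normSq_apply]

lemma rootsOfUnity_two_eq :
    (fun k : Fin 2 => Complex.exp (2 * Real.pi * Complex.I * (((k : ℕ) : ℂ) + 1) / ((2 : ℕ) : ℂ)))
      = ![-1, 1] := by
  ext k
  fin_cases k
  · have h : 2 * (Real.pi : ℂ) * Complex.I * (((0 : ℕ) : ℂ) + 1) / ((2 : ℕ) : ℂ)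
        = Real.pi * Complex.I := by push_cast; ring
    simpa using (congrArg Complex.exp h).trans Complex.exp_pi_mul_I
  · have h : 2 * (Real.pi : ℂ) * Complex.I * (((1 : ℕ) : ℂ) + 1) / ((2 : ℕ) : ℂ)
        = 2 * Real.pi * Complex.I := by push_cast; ring
    simpa using (congrArg Complex.exp h).trans Complex.exp_two_pi_mul_I

/-- Conjugation by `diag(-1, 1)` flips the sign of the off-diagonal blocks, so only these
contribute to the distance. -/
lemma DU_diagonal {N : ℕ} {ρ : Matrix (Fin 2 × Fin N) (Fin 2 × Fin N) ℂ} (hρ : ρ.IsHermitian) :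
    DU ρ (diagonal ![-1, 1]) = 2 * Real.sqrt (∑ j, ∑ k, ‖ρ (0, j) (1, k)‖ ^ 2) := by
  have hsymm (j k : Fin N) : ‖ρ (1, j) (0, k)‖ = ‖ρ (0, k) (1, j)‖ := by
    rw [← hρ.apply (1, j) (0, k), norm_star]
  have hsum : ∑ x, ∑ y, ‖(ρ - conjA (diagonal ![-1, 1]) ρ) y x‖ ^ 2
      = 2 * (2 ^ 2 * ∑ j, ∑ k, ‖ρ (0, j) (1, k)‖ ^ 2) := by
    have hcomm : ∑ j, ∑ k, ‖ρ (0, k) (1, j)‖ ^ 2 = ∑ j, ∑ k, ‖ρ (0, j) (1, k)‖ ^ 2 :=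
      Finset.sum_comm
    have htwo (z : ℂ) : ‖z + z‖ ^ 2 = 4 * ‖z‖ ^ 2 := by
      rw [← two_mul, norm_mul, mul_pow]; norm_num
    simp only [Fintype.sum_prod_type, Fin.sum_univ_two, Matrix.sub_apply, conjA_apply]
    simp [htwo, hsymm, hcomm, ← Finset.mul_sum]
    ring
  rw [DU, frob_eq_sqrt_sum, hsum, Real.sqrt_mul (by norm_num), Real.sqrt_mul (by norm_num),
    Real.sqrt_sq (by norm_num)]
  field_simp

lemma DU_conj {M N : ℕ} {V : Matrix (Fin M) (Fin M) ℂ} (hV : Vᴴ * V = 1)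
    (D : Matrix (Fin M) (Fin M) ℂ) (ρ : Matrix (Fin M × Fin N) (Fin M × Fin N) ℂ) :
    DU ρ (V * D * Vᴴ) = DU (conjA Vᴴ ρ) D := by
  have hρ : ρ = conjA V (conjA Vᴴ ρ) := by
    rw [← conjA_mul, mul_eq_one_comm.mp hV, conjA_one]
  rw [DU, DU, conjA_mul, conjA_mul]
  nth_rewrite 1 [hρ]
  rw [← conjA_sub, frob_conjA hV]

lemma Dm_le_DU {M N : ℕ} (ρ : Matrix (Fin M × Fin N) (Fin M × Fin N) ℂ)
    {U : Matrix (Fin M) (Fin M) ℂ} (hU : IsRU U) : Dm ρ ≤ DU ρ U := by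
  refine csInf_le ⟨0, ?_⟩ ⟨U, hU, rfl⟩
  rintro d ⟨U', -, rfl⟩
  exact mul_nonneg (by positivity) (Real.sqrt_nonneg _)

lemma sum_offDiag_le_traceB_sq {N : ℕ} {ρ : Matrix (Fin 2 × Fin N) (Fin 2 × Fin N) ℂ}
    (hρ : ρ.IsHermitian) (i : Fin 2) :
    ∑ j, ∑ k, ‖ρ (0, j) (1, k)‖ ^ 2 ≤ (traceB (ρ * ρ) i i).re := by
  rw [traceB_sq_apply_self_re hρ]
  simp only [Fin.sum_univ_two, Finset.sum_add_distrib]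
  fin_cases i
  · exact le_add_of_nonneg_left (by positivity)
  · have hsymm (j k : Fin N) : ‖ρ (1, j) (0, k)‖ = ‖ρ (0, k) (1, j)‖ := by
      rw [← hρ.apply (1, j) (0, k), norm_star]
    simp only [Fin.mk_one, hsymm]
    rw [Finset.sum_comm]
    exact le_add_of_nonneg_right (by positivity)

/-- For any bipartite quantum state `ρ` on `ℂ² ⊗ ℂ^N`,
`D(ρ) ≤ 2·√(λ_min(Tr_B(ρ²)))`. -/
theorem D_le_sqrt_lambdaMin {N : ℕ}
    (ρ : Matrix (Fin 2 × Fin N) (Fin 2 × Fin N) ℂ) (hρ : IsState ρ) :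
    Dm ρ ≤ 2 * Real.sqrt
      (⨅ i, (traceB_isHermitian (isHermitian_sq hρ.1.isHermitian)).eigenvalues i) := by
  set hH := traceB_isHermitian (isHermitian_sq hρ.1.isHermitian)
  set V := (hH.eigenvectorUnitary : Matrix (Fin 2) (Fin 2) ℂ)
  have hV : Vᴴ * V = 1 := Unitary.coe_star_mul_self hH.eigenvectorUnitary
  have hV' : Vᴴᴴ * Vᴴ = 1 := by rw [conjTranspose_conjTranspose, mul_eq_one_comm.mp hV]
  have hσ : (conjA Vᴴ ρ).IsHermitian := by
    rw [Matrix.IsHermitian, conjTranspose_conjA, hρ.1.isHermitian]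
  have hdiag : traceB (conjA Vᴴ ρ * conjA Vᴴ ρ) = diagonal (RCLike.ofReal ∘ hH.eigenvalues) := by
    rw [conjA_mul_conjA hV', traceB_conjA, ← hH.conjStarAlgAut_star_eigenvectorUnitary,
      Unitary.conjStarAlgAut_star_apply, conjTranspose_conjTranspose]
    rfl
  have hRU : IsRU (V * diagonal ![-1, 1] * Vᴴ) :=
    ⟨V, hH.eigenvectorUnitary.2, by rw [rootsOfUnity_two_eq]⟩
  refine (Dm_le_DU ρ hRU).trans ?_
  rw [DU_conj hV, DU_diagonal hσ]
  gcongr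
  refine le_ciInf fun i => ?_
  simpa [hdiag] using sum_offDiag_le_traceB_sq hσ i

end
end

section
/- Let ρ be a bipartite quantum state on ℂ² ⊗ ℂ^N. Let σ_1,σ_2,σ_3 be the Pauli matrices, and let {σ^B_j}_{j=1}^{N²−1} be any family of traceless Hermitian N×N matrices satisfying tr(σ^B_i σ^B_j) = 2δ_{ij}. Define the Bloch vector r ∈ ℝ³ by r_i = tr(ρ (σ_i ⊗ I_N)) and the correlation matrix T ∈ ℝ^{3×(N²−1)} by T_{ij} = (N/2)·tr(ρ (σ_i ⊗ σ^B_j)). Then D(ρ) = (1/√N)·√( ‖r‖² + (2/N)·Σ_{i,j} T_{ij}² − λ_max( r rᵀ + (2/N) T Tᵀ ) ), where λ_max denotes the largest eigenvalue of the indicated symmetric 3×3 matrix. -/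
open Matrix Kronecker BigOperators ComplexOrder

noncomputable section

/-- Bloch vector of the `A` (qubit) subsystem: `r_i = tr(ρ (σ_i ⊗ I_N))`. -/
def blochA {N : ℕ} (ρ : Matrix (Fin 2 × Fin N) (Fin 2 × Fin N) ℂ) : Fin 3 → ℝ :=
  fun i => (Matrix.trace (ρ * (pauli i ⊗ₖ (1 : Matrix (Fin N) (Fin N) ℂ)))).re

/-- Correlation matrix `T_{ij} = (N/2)·tr(ρ (σ_i ⊗ σ^B_j))`. -/
def corrT {N : ℕ} (ρ : Matrix (Fin 2 × Fin N) (Fin 2 × Fin N) ℂ)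
    (σB : Fin (N ^ 2 - 1) → Matrix (Fin N) (Fin N) ℂ) :
    Matrix (Fin 3) (Fin (N ^ 2 - 1)) ℝ :=
  Matrix.of fun i j => (N / 2 : ℝ) * (Matrix.trace (ρ * (pauli i ⊗ₖ σB j))).re

lemma isHermitian_comb {n m : ℕ} (r : Fin n → ℝ) (T : Matrix (Fin n) (Fin m) ℝ) (c : ℝ) :
    ((Matrix.of fun i j => r i * r j) + c • (T * Tᵀ)).IsHermitian := by
  ext i j
  simp only [Matrix.conjTranspose_apply, Matrix.add_apply, Matrix.smul_apply, Matrix.of_apply,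
    Matrix.mul_apply, Matrix.transpose_apply, star_trivial, smul_eq_mul]
  rw [mul_comm (r j) (r i)]
  congr 1
  congr 1
  exact Finset.sum_congr rfl fun k _ => mul_comm _ _

/-- The observable `n · σ` attached to `n ∈ ℝ³`. -/
def pauliDot (n : Fin 3 → ℝ) : Matrix (Fin 2) (Fin 2) ℂ :=
  ∑ i, (n i : ℂ) • pauli i

lemma pauliDot_eq (n : Fin 3 → ℝ) :
    pauliDot n = !![(n 2 : ℂ), n 0 - n 1 * Complex.I; n 0 + n 1 * Complex.I, -n 2] := by
  ext i j
  fin_cases i <;> fin_cases j <;> simp [pauliDot, pauli, Fin.sum_univ_three, sub_eq_add_neg]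

lemma pauliDot_isHermitian (n : Fin 3 → ℝ) : (pauliDot n).IsHermitian := by
  rw [pauliDot_eq]
  ext i j
  fin_cases i <;> fin_cases j <;> simp [sub_eq_add_neg]

lemma pauliDot_neg (n : Fin 3 → ℝ) : pauliDot (-n) = -pauliDot n := by
  simp [pauliDot]

lemma pauliDot_mul_self (n : Fin 3 → ℝ) :
    pauliDot n * pauliDot n = ((∑ i, n i ^ 2 : ℝ) : ℂ) • 1 := by
  rw [pauliDot_eq]
  ext i j
  fin_cases i <;> fin_cases j <;>
    simp [Matrix.mul_apply, Fin.sum_univ_three] <;> ring_nf <;> simp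

lemma trace_pauliDot (n : Fin 3 → ℝ) : (pauliDot n).trace = 0 := by
  simp [pauliDot_eq, Matrix.trace_fin_two]

lemma exists_eq_pauliDot {U : Matrix (Fin 2) (Fin 2) ℂ} (hU : U.IsHermitian)
    (htr : U.trace = 0) : ∃ n, U = pauliDot n := by
  refine ⟨![(U 1 0).re, (U 1 0).im, (U 0 0).re], ?_⟩
  have h00 := hU.apply 0 0
  have h01 := hU.apply 0 1
  rw [Matrix.trace_fin_two] at htr
  have h11 : U 1 1 = -U 0 0 := by linear_combination htr
  rw [Complex.star_def, Complex.conj_eq_iff_re] at h00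
  rw [pauliDot_eq]
  ext i j
  fin_cases i <;> fin_cases j
  · simpa using h00.symm
  · simp only [Fin.zero_eta, Fin.mk_one, ← h01]
    apply Complex.ext <;> simp
  · apply Complex.ext <;> simp
  · simpa [h11] using h00.symm

lemma isRU_two_iff (U : Matrix (Fin 2) (Fin 2) ℂ) :
    IsRU U ↔ ∃ V ∈ Matrix.unitaryGroup (Fin 2) ℂ, U = V * Matrix.diagonal ![-1, 1] * Vᴴ := by
  have h : (fun k : Fin 2 => Complex.exp (2 * Real.pi * Complex.I * (((k : ℕ) : ℂ) + 1) /
      ((2 : ℕ) : ℂ))) = ![-1, 1] := by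
    funext k
    fin_cases k
    · rw [show 2 * (Real.pi : ℂ) * Complex.I * (((⟨0, _⟩ : Fin 2) : ℕ) + 1) / (2 : ℕ) =
        Real.pi * Complex.I by simp; ring, Complex.exp_pi_mul_I]
      simp
    · norm_num
  unfold IsRU
  rw [h]

lemma IsRU.exists_eq_pauliDot {U : Matrix (Fin 2) (Fin 2) ℂ} (hU : IsRU U) :
    ∃ n : Fin 3 → ℝ, ∑ i, n i ^ 2 = 1 ∧ U = pauliDot n := by
  obtain ⟨V, hV, rfl⟩ := (isRU_two_iff U).1 hU
  have hV' : Vᴴ * V = 1 := Matrix.mem_unitaryGroup_iff'.1 hV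
  have hV'' : V * Vᴴ = 1 := Matrix.mem_unitaryGroup_iff.1 hV
  have hsq : Matrix.diagonal ![(-1 : ℂ), 1] * Matrix.diagonal ![(-1 : ℂ), 1] = 1 := by
    ext i j
    fin_cases i <;> fin_cases j <;> simp
  obtain ⟨n, hn⟩ := _root_.exists_eq_pauliDot
    (U := V * Matrix.diagonal ![-1, 1] * Vᴴ)
    (Matrix.isHermitian_mul_mul_conjTranspose V (Matrix.isHermitian_diagonal_of_self_adjoint _ (by
      ext i; fin_cases i <;> simp)))
    (by rw [Matrix.mul_assoc, Matrix.trace_mul_comm, Matrix.mul_assoc, hV']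
        simp)
  refine ⟨n, ?_, hn⟩
  have h1 := pauliDot_mul_self n
  rw [← hn] at h1
  have h2 : V * Matrix.diagonal ![-1, 1] * Vᴴ * (V * Matrix.diagonal ![-1, 1] * Vᴴ) = 1 := by
    calc _ = V * Matrix.diagonal ![-1, 1] * (Vᴴ * V) * Matrix.diagonal ![-1, 1] * Vᴴ := by
            simp only [Matrix.mul_assoc]
      _ = V * (Matrix.diagonal ![-1, 1] * Matrix.diagonal ![-1, 1]) * Vᴴ := by
            rw [hV']; simp only [Matrix.mul_assoc, Matrix.one_mul]
      _ = 1 := by rw [hsq, Matrix.mul_one, hV'']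
  rw [h2] at h1
  have h3 := congrFun (congrFun h1 0) 0
  simp only [Matrix.one_apply_eq, Matrix.smul_apply, smul_eq_mul, mul_one] at h3
  exact_mod_cast h3.symm

lemma isRU_pauliDot_or_neg {n : Fin 3 → ℝ} (hn : ∑ i, n i ^ 2 = 1) :
    IsRU (pauliDot n) ∨ IsRU (-pauliDot n) := by
  have hH := pauliDot_isHermitian n
  set V := hH.eigenvectorUnitary
  set e := hH.eigenvalues
  have hspec : pauliDot n = V.1 * Matrix.diagonal (fun i => (e i : ℂ)) * V.1ᴴ := by
    have := hH.spectral_theorem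
    rw [Unitary.conjStarAlgAut_apply] at this
    exact this
  have hV' : V.1ᴴ * V.1 = 1 := Matrix.mem_unitaryGroup_iff'.1 V.2
  have htr : e 0 + e 1 = 0 := by
    have := hH.trace_eq_sum_eigenvalues
    rw [trace_pauliDot, Fin.sum_univ_two] at this
    have h : (0 : ℂ) = e 0 + e 1 := this
    exact_mod_cast h.symm
  have hsq : e 0 ^ 2 = 1 := by
    have h1 : V.1ᴴ * (pauliDot n * pauliDot n) * V.1 = 1 := by
      simp [pauliDot_mul_self, hn, hV']
    have h2 : V.1ᴴ * (pauliDot n * pauliDot n) * V.1 =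
        Matrix.diagonal (fun i => (e i : ℂ)) * Matrix.diagonal (fun i => (e i : ℂ)) := by
      rw [hspec]
      calc _ = (V.1ᴴ * V.1) * Matrix.diagonal (fun i => (e i : ℂ)) * (V.1ᴴ * V.1) *
            Matrix.diagonal (fun i => (e i : ℂ)) * (V.1ᴴ * V.1) := by
              simp only [Matrix.mul_assoc]
        _ = _ := by rw [hV']; simp only [Matrix.mul_one, Matrix.one_mul]
    rw [h1, Matrix.diagonal_mul_diagonal] at h2
    have h3 := congrFun (congrFun h2 0) 0
    simp only [Matrix.one_apply_eq, Matrix.diagonal_apply_eq] at h3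
    rw [sq]
    exact_mod_cast h3.symm
  simp only [isRU_two_iff]
  rcases eq_or_eq_neg_of_sq_eq_sq _ _ (hsq.trans (one_pow 2).symm) with h | h
  · right
    have he : (fun i => (e i : ℂ)) = -![-1, 1] := by
      ext i
      fin_cases i
      · simp [h]
      · simp [show e 1 = -1 by linarith]
    refine ⟨V.1, V.2, ?_⟩
    rw [hspec, he, show Matrix.diagonal (-![(-1 : ℂ), 1]) = -Matrix.diagonal ![-1, 1] from
      (Matrix.diagonal_neg _).symm, Matrix.mul_neg, Matrix.neg_mul, neg_neg]
  · left
    have he : (fun i => (e i : ℂ)) = ![-1, 1] := by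
      ext i
      fin_cases i
      · simp [h]
      · simp [show e 1 = 1 by linarith]
    exact ⟨V.1, V.2, he ▸ hspec⟩

lemma Matrix.IsHermitian.isGreatest_quadForm {ι : Type*} [Fintype ι] [DecidableEq ι] [Nonempty ι]
    {A : Matrix ι ι ℝ} (hA : A.IsHermitian) :
    IsGreatest {x | ∃ n : ι → ℝ, ∑ i, n i ^ 2 = 1 ∧ x = n ⬝ᵥ A *ᵥ n} (⨆ k, hA.eigenvalues k) := by
  constructor
  · obtain ⟨k, hk⟩ := exists_eq_ciSup_of_finite (f := hA.eigenvalues)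
    have hnorm : ∑ i, hA.eigenvectorBasis k i ^ 2 = 1 := by
      have := hA.eigenvectorBasis.orthonormal.1 k
      rw [EuclideanSpace.norm_eq, Real.sqrt_eq_one] at this
      simpa using this
    refine ⟨hA.eigenvectorBasis k, hnorm, ?_⟩
    rw [hA.mulVec_eigenvectorBasis, dotProduct_smul, ← hk, dotProduct]
    simp only [← sq, hnorm, smul_eq_mul, mul_one]
  · rintro x ⟨n, hn, rfl⟩
    set V := hA.eigenvectorUnitary
    have hspec : A = V.1 * Matrix.diagonal hA.eigenvalues * V.1ᵀ := by
      have := hA.spectral_theorem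
      rw [Unitary.conjStarAlgAut_apply] at this
      exact this
    have hV : V.1 * V.1ᵀ = 1 := Matrix.mem_unitaryGroup_iff.1 V.2
    have hq : ∀ B : Matrix ι ι ℝ, n ⬝ᵥ (V.1 * B * V.1ᵀ) *ᵥ n =
        (V.1ᵀ *ᵥ n) ⬝ᵥ B *ᵥ (V.1ᵀ *ᵥ n) := by
      intro B
      rw [← Matrix.mulVec_mulVec, ← Matrix.mulVec_mulVec, Matrix.dotProduct_mulVec,
        ← Matrix.mulVec_transpose]
    set m := V.1ᵀ *ᵥ n
    have hm : ∑ i, m i ^ 2 = 1 := by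
      have := hq 1
      rw [Matrix.mul_one, hV, Matrix.one_mulVec, Matrix.one_mulVec, dotProduct, dotProduct] at this
      simpa only [← sq, hn] using this.symm
    have h := hq (Matrix.diagonal hA.eigenvalues)
    rw [← hspec] at h
    rw [h]
    calc _ = ∑ i, hA.eigenvalues i * m i ^ 2 := by
          simp only [dotProduct, Matrix.mulVec_diagonal]
          exact Finset.sum_congr rfl fun i _ => by ring
      _ ≤ ∑ i, (⨆ k, hA.eigenvalues k) * m i ^ 2 := by
          gcongr with i
          exact le_ciSup (Set.finite_range _).bddAbove i
      _ = _ := by rw [← Finset.mul_sum, hm, mul_one]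

/-- Expansion of the trace form along an orthogonal basis made of the identity and a family of
generalized Gell-Mann matrices. -/
lemma trace_mul_eq_of_orthogonal {N : ℕ} (hN : 0 < N)
    (σB : Fin (N ^ 2 - 1) → Matrix (Fin N) (Fin N) ℂ)
    (htrace : ∀ j, (σB j).trace = 0)
    (horth : ∀ i j, (σB i * σB j).trace = if i = j then 2 else 0)
    (A B : Matrix (Fin N) (Fin N) ℂ) :
    (A * B).trace = 1 / N * (A.trace * B.trace) +
      1 / 2 * ∑ j, (A * σB j).trace * (B * σB j).trace := by
  have hN' : (N : ℂ) ≠ 0 := by exact_mod_cast hN.ne'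
  let e : Option (Fin (N ^ 2 - 1)) → Matrix (Fin N) (Fin N) ℂ := fun o => o.elim 1 σB
  have hself : ∀ j, (σB j * σB j).trace = 2 := fun j => by simp [horth]
  have hcoef : ∀ g : Option (Fin (N ^ 2 - 1)) → ℂ, (∑ i, g i • e i).trace = N * g none ∧
      ∀ j, ((∑ i, g i • e i) * σB j).trace = 2 * g (some j) := by
    intro g
    constructor
    · simp [Fintype.sum_option, e, Matrix.trace_add, Matrix.trace_sum, htrace, mul_comm]
    · intro j
      simp [Fintype.sum_option, e, Matrix.add_mul, Finset.sum_mul, Matrix.trace_sum, htrace, horth,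
        mul_comm]
  have hli : LinearIndependent ℂ e := by
    rw [Fintype.linearIndependent_iff]
    intro g hg i
    obtain ⟨h1, h2⟩ := hcoef g
    rw [hg] at h1 h2
    cases i with
    | none => simpa [hN'] using h1.symm
    | some j => simpa using (h2 j).symm
  have hspan : Submodule.span ℂ (Set.range e) = ⊤ := by
    apply hli.span_eq_top_of_card_eq_finrank'
    have : 0 < N ^ 2 := by positivity
    simp [Module.finrank_matrix]
    rw [← sq]
    omega
  have hA : A ∈ Submodule.span ℂ (Set.range e) := hspan ▸ Submodule.mem_top
  obtain ⟨g, rfl⟩ := (Submodule.mem_span_range_iff_exists_fun ℂ).1 hA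
  obtain ⟨h1, h2⟩ := hcoef g
  simp only [h1, h2]
  simp only [Fintype.sum_option, e, Option.elim, Matrix.add_mul, Finset.sum_mul, Matrix.trace_add,
    Matrix.trace_sum, Matrix.smul_mul, Matrix.one_mul, Matrix.trace_smul, smul_eq_mul,
    Finset.mul_sum]
  congr 1
  · field_simp
  · refine Finset.sum_congr rfl fun j _ => ?_
    rw [Matrix.trace_mul_comm (σB j)]
    ring

/-- The operator `tr_A (ρ (A ⊗ I))` on the second tensor factor. -/
def redB {N : ℕ} (ρ : Matrix (Fin 2 × Fin N) (Fin 2 × Fin N) ℂ) (A : Matrix (Fin 2) (Fin 2) ℂ) :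
    Matrix (Fin N) (Fin N) ℂ :=
  ∑ k, ∑ l, A l k • ρ.submatrix (Prod.mk k) (Prod.mk l)

lemma trace_mul_kronecker_eq {N : ℕ} (ρ : Matrix (Fin 2 × Fin N) (Fin 2 × Fin N) ℂ)
    (A : Matrix (Fin 2) (Fin 2) ℂ) (B : Matrix (Fin N) (Fin N) ℂ) :
    (ρ * (A ⊗ₖ B)).trace = (redB ρ A * B).trace := by
  simp only [redB, Matrix.trace, Matrix.diag, Matrix.mul_apply, Matrix.kroneckerMap_apply,
    Fintype.sum_prod_type, Fin.sum_univ_two, Matrix.add_apply, Matrix.smul_apply,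
    Matrix.submatrix_apply, smul_eq_mul, ← Finset.sum_add_distrib]
  refine Finset.sum_congr rfl fun i _ => Finset.sum_congr rfl fun j _ => ?_
  ring

lemma trace_mul_eq_blocks {N : ℕ} (X Y : Matrix (Fin 2 × Fin N) (Fin 2 × Fin N) ℂ) :
    (X * Y).trace = ∑ i, ∑ j,
      (X.submatrix (Prod.mk i) (Prod.mk j) * Y.submatrix (Prod.mk j) (Prod.mk i)).trace := by
  simp only [Matrix.trace, Matrix.diag, Matrix.mul_apply, Fintype.sum_prod_type,
    Matrix.submatrix_apply]
  refine Finset.sum_congr rfl fun i _ => ?_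
  rw [Finset.sum_comm]

lemma mul_kronecker_one_submatrix {N : ℕ} (X : Matrix (Fin 2 × Fin N) (Fin 2 × Fin N) ℂ)
    (U : Matrix (Fin 2) (Fin 2) ℂ) (i j : Fin 2) :
    (X * (U ⊗ₖ (1 : Matrix (Fin N) (Fin N) ℂ))).submatrix (Prod.mk i) (Prod.mk j) =
      ∑ k, U k j • X.submatrix (Prod.mk i) (Prod.mk k) := by
  ext a b
  simp [Matrix.mul_apply, Fintype.sum_prod_type, Matrix.one_apply, Matrix.sum_apply, mul_comm]

lemma trace_sub_trace_conj {N : ℕ} (ρ : Matrix (Fin 2 × Fin N) (Fin 2 × Fin N) ℂ)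
    {n : Fin 3 → ℝ} (hn : ∑ i, n i ^ 2 = 1) :
    (ρ * ρ).trace - ((ρ * (pauliDot n ⊗ₖ (1 : Matrix (Fin N) (Fin N) ℂ))) *
        (ρ * (pauliDot n ⊗ₖ (1 : Matrix (Fin N) (Fin N) ℂ)))).trace =
      ∑ i, (redB ρ (pauli i) * redB ρ (pauli i)).trace -
        ∑ i, ∑ j, (n i * n j : ℂ) * (redB ρ (pauli i) * redB ρ (pauli j)).trace := by
  have hn' : (n 0 : ℂ) ^ 2 + (n 1 : ℂ) ^ 2 + (n 2 : ℂ) ^ 2 = 1 := by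
    rw [Fin.sum_univ_three] at hn
    exact_mod_cast hn
  rw [trace_mul_eq_blocks, trace_mul_eq_blocks]
  simp only [mul_kronecker_one_submatrix, redB, pauliDot_eq, pauli, Fin.sum_univ_two,
    Fin.sum_univ_three]
  generalize ρ.submatrix (Prod.mk 0) (Prod.mk 0) = a
  generalize ρ.submatrix (Prod.mk 0) (Prod.mk 1) = b
  generalize ρ.submatrix (Prod.mk 1) (Prod.mk 0) = c
  generalize ρ.submatrix (Prod.mk 1) (Prod.mk 1) = d
  simp [Matrix.add_mul, Matrix.mul_add]
  rw [Matrix.trace_mul_comm b a, Matrix.trace_mul_comm c a, Matrix.trace_mul_comm d a,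
    Matrix.trace_mul_comm c b, Matrix.trace_mul_comm d b, Matrix.trace_mul_comm d c]
  generalize (a * a).trace = aa
  generalize (a * b).trace = ab
  generalize (a * c).trace = ac
  generalize (a * d).trace = ad
  generalize (b * b).trace = bb
  generalize (b * c).trace = bc
  generalize (b * d).trace = bd
  generalize (c * c).trace = cc
  generalize (c * d).trace = cd
  generalize (d * d).trace = dd
  linear_combination (norm := (ring_nf; simp)) -(2 * ad - 2 * bc) * hn'

lemma DU_pauliDot {N : ℕ} {ρ : Matrix (Fin 2 × Fin N) (Fin 2 × Fin N) ℂ} (hρ : ρ.IsHermitian)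
    {n : Fin 3 → ℝ} (hn : ∑ i, n i ^ 2 = 1) :
    DU ρ (pauliDot n) = Real.sqrt
      (∑ i, (redB ρ (pauli i) * redB ρ (pauli i)).trace -
        ∑ i, ∑ j, (n i * n j : ℂ) * (redB ρ (pauli i) * redB ρ (pauli j)).trace).re := by
  rw [← trace_sub_trace_conj ρ hn]
  set K := pauliDot n ⊗ₖ (1 : Matrix (Fin N) (Fin N) ℂ) with hK
  have hKH : Kᴴ = K := by
    rw [hK, Matrix.conjTranspose_kronecker, (pauliDot_isHermitian n).eq, Matrix.conjTranspose_one]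
  have hKK : K * K = 1 := by
    rw [hK, ← Matrix.mul_kronecker_mul, pauliDot_mul_self, hn]
    simp
  have hX : (ρ - K * ρ * K)ᴴ = ρ - K * ρ * K := by
    rw [Matrix.conjTranspose_sub, Matrix.conjTranspose_mul, Matrix.conjTranspose_mul, hKH, hρ.eq,
      Matrix.mul_assoc]
  have htr : ((ρ - K * ρ * K) * (ρ - K * ρ * K)).trace =
      2 * ((ρ * ρ).trace - (ρ * K * (ρ * K)).trace) := by
    have h1 : (ρ * (K * ρ * K)).trace = (ρ * K * (ρ * K)).trace := by
      simp only [Matrix.mul_assoc]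
    have h2 : (K * ρ * K * ρ).trace = (ρ * K * (ρ * K)).trace := by
      rw [Matrix.trace_mul_comm, h1]
    have h3 : (K * ρ * K * (K * ρ * K)).trace = (ρ * ρ).trace := by
      calc _ = (K * (ρ * (K * K) * ρ * K)).trace := by simp only [Matrix.mul_assoc]
        _ = (ρ * (K * K) * ρ * (K * K)).trace := by
          rw [Matrix.trace_mul_comm]; simp only [Matrix.mul_assoc]
        _ = _ := by simp [hKK]
    rw [Matrix.sub_mul, Matrix.mul_sub, Matrix.mul_sub, Matrix.trace_sub, Matrix.trace_sub,
      Matrix.trace_sub, h1, h2, h3]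
    ring
  unfold DU frob conjA
  rw [← hK, hKH, hX, htr, Complex.mul_re]
  simp only [Complex.re_ofNat, Complex.im_ofNat, zero_mul, sub_zero]
  rw [Real.sqrt_mul (by norm_num)]
  field_simp

lemma Matrix.IsHermitian.trace_mul_eq_ofReal_re {ι : Type*} [Fintype ι] {A B : Matrix ι ι ℂ} (hA : A.IsHermitian)
    (hB : B.IsHermitian) : (A * B).trace = ((A * B).trace.re : ℂ) := by
  symm
  rw [← Complex.conj_eq_iff_re, starRingEnd_apply, ← Matrix.trace_conjTranspose,
    Matrix.conjTranspose_mul, hA.eq, hB.eq, Matrix.trace_mul_comm]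

lemma pauli_isHermitian (i : Fin 3) : (pauli i).IsHermitian := by
  ext k l
  fin_cases i <;> fin_cases k <;> fin_cases l <;> simp [pauli]

lemma trace_redB_mul_redB {N : ℕ} (hN : 0 < N)
    {ρ : Matrix (Fin 2 × Fin N) (Fin 2 × Fin N) ℂ} (hρ : ρ.IsHermitian)
    (σB : Fin (N ^ 2 - 1) → Matrix (Fin N) (Fin N) ℂ)
    (hherm : ∀ j, (σB j).IsHermitian)
    (htrace : ∀ j, (σB j).trace = 0)
    (horth : ∀ i j, (σB i * σB j).trace = if i = j then 2 else 0) (i j : Fin 3) :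
    (redB ρ (pauli i) * redB ρ (pauli j)).trace =
      ((1 / N * ((Matrix.of fun i j => blochA ρ i * blochA ρ j) +
        (2 / N : ℝ) • (corrT ρ σB * (corrT ρ σB)ᵀ)) i j : ℝ) : ℂ) := by
  have hN' : (N : ℂ) ≠ 0 := by exact_mod_cast hN.ne'
  have hr : ∀ i, (redB ρ (pauli i)).trace = (blochA ρ i : ℂ) := by
    intro i
    rw [blochA, ← Matrix.IsHermitian.trace_mul_eq_ofReal_re hρ, trace_mul_kronecker_eq, Matrix.mul_one]
    rw [Matrix.IsHermitian, Matrix.conjTranspose_kronecker, (pauli_isHermitian i).eq,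
      Matrix.conjTranspose_one]
  have hT : ∀ i j, (redB ρ (pauli i) * σB j).trace = 2 / N * (corrT ρ σB i j : ℂ) := by
    intro i j
    rw [corrT, Matrix.of_apply, Complex.ofReal_mul, ← Matrix.IsHermitian.trace_mul_eq_ofReal_re hρ,
      trace_mul_kronecker_eq]
    · push_cast
      field_simp
    · rw [Matrix.IsHermitian, Matrix.conjTranspose_kronecker, (pauli_isHermitian i).eq,
        (hherm j).eq]
  rw [trace_mul_eq_of_orthogonal hN σB htrace horth]
  simp only [hr, hT, Matrix.add_apply, Matrix.of_apply, Matrix.smul_apply, Matrix.mul_apply,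
    Matrix.transpose_apply, smul_eq_mul]
  push_cast
  rw [mul_add, Finset.mul_sum, Finset.mul_sum, Finset.mul_sum]
  congr 1
  refine Finset.sum_congr rfl fun k _ => ?_
  field_simp

/-- Closed form for `D(ρ)` on `ℂ² ⊗ ℂ^N`:
`D(ρ) = (1/√N)·√(‖r‖² + (2/N)·Σ T_{ij}² − λ_max(r rᵀ + (2/N) T Tᵀ))`. -/
theorem D_closed_form {N : ℕ} (hN : 0 < N)
    (ρ : Matrix (Fin 2 × Fin N) (Fin 2 × Fin N) ℂ) (hρ : IsState ρ)
    (σB : Fin (N ^ 2 - 1) → Matrix (Fin N) (Fin N) ℂ)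
    (hherm : ∀ j, (σB j).IsHermitian)
    (htrace : ∀ j, (σB j).trace = 0)
    (horth : ∀ i j, (σB i * σB j).trace = if i = j then 2 else 0) :
    Dm ρ = (1 / Real.sqrt N) * Real.sqrt
      ((∑ i, blochA ρ i ^ 2) + (2 / N) * (∑ i, ∑ j, corrT ρ σB i j ^ 2)
        - ⨆ k, (isHermitian_comb (blochA ρ) (corrT ρ σB) (2 / N)).eigenvalues k) := by

  set r := blochA ρ with hr
  set T := corrT ρ σB with hT
  set G := (Matrix.of fun i j => r i * r j) + (2 / N : ℝ) • (T * Tᵀ) with hG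
  have hGH : G.IsHermitian := isHermitian_comb r T (2 / N)
  change Dm ρ = 1 / Real.sqrt N * Real.sqrt (_ - ⨆ k, hGH.eigenvalues k)
  have hS : (∑ i, r i ^ 2) + (2 / N) * (∑ i, ∑ j, T i j ^ 2) = ∑ i, G i i := by
    simp only [hG, Matrix.add_apply, Matrix.of_apply, Matrix.smul_apply, Matrix.mul_apply,
      Matrix.transpose_apply, smul_eq_mul, Finset.sum_add_distrib, Finset.mul_sum, sq]
  rw [hS]
  have hDU : ∀ n : Fin 3 → ℝ, ∑ i, n i ^ 2 = 1 → DU ρ (pauliDot n) =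
      1 / Real.sqrt N * Real.sqrt (∑ i, G i i - n ⬝ᵥ G *ᵥ n) := by
    intro n hn
    rw [DU_pauliDot hρ.1.isHermitian hn]
    simp only [trace_redB_mul_redB hN hρ.1.isHermitian σB hherm htrace horth, ← hr, ← hT, ← hG]
    norm_cast
    rw [one_div (Real.sqrt N), ← Real.sqrt_inv, ← one_div, ← Real.sqrt_mul (by positivity)]
    congr 1
    simp only [dotProduct, Matrix.mulVec, Finset.mul_sum, mul_sub]
    congr 1
    exact Finset.sum_congr rfl fun i _ => Finset.sum_congr rfl fun j _ => by ring
  obtain ⟨⟨n, hn, hmax⟩, hub⟩ := hGH.isGreatest_quadForm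
  refine IsLeast.csInf_eq ⟨?_, ?_⟩
  · rw [hmax]
    rcases isRU_pauliDot_or_neg hn with h | h
    · exact ⟨_, h, (hDU n hn).symm⟩
    · refine ⟨_, h, ?_⟩
      rw [← pauliDot_neg, hDU (-n) (by simpa using hn), Matrix.mulVec_neg, neg_dotProduct_neg]
  · rintro d ⟨U, hU, rfl⟩
    obtain ⟨m, hm, rfl⟩ := hU.exists_eq_pauliDot
    rw [hDU m hm]
    gcongr
    exact hub ⟨m, hm, rfl⟩

end
end

section
/- Let ρ be a bipartite quantum state on ℂ² ⊗ ℂ^N with correlation matrix T ∈ ℝ^{3×(N²−1)} given by T_{ij} = (N/2)·tr(ρ (σ_i ⊗ σ^B_j)), where σ_1,σ_2,σ_3 are the Pauli matrices and {σ^B_j}_{j=1}^{N²−1} is any family of traceless Hermitian N×N matrices with tr(σ^B_i σ^B_j) = 2δ_{ij}. Then D(ρ) ≥ (√2/N)·√( Σ_{i,j} T_{ij}² − λ_max(T Tᵀ) ), where λ_max denotes the largest eigenvalue. -/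
open Matrix Kronecker BigOperators ComplexOrder

noncomputable section

lemma real_isHermitian_mul_transpose_self {n m : ℕ} (T : Matrix (Fin n) (Fin m) ℝ) :
    (T * Tᵀ).IsHermitian := by
  ext i j
  simp only [Matrix.conjTranspose_apply, Matrix.mul_apply, Matrix.transpose_apply, star_trivial]
  exact Finset.sum_congr rfl fun k _ => mul_comm _ _

/-- The Rayleigh quotient of a real symmetric matrix is at most its largest eigenvalue. -/
lemma dotProduct_mulVec_le_iSup_eigenvalues {n : Type*} [Fintype n] [DecidableEq n]
    {A : Matrix n n ℝ} (hA : A.IsHermitian) (x : n → ℝ) :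
    x ⬝ᵥ A *ᵥ x ≤ (⨆ k, hA.eigenvalues k) * (x ⬝ᵥ x) := by
  obtain ⟨W, hW⟩ : ∃ W : Matrix n n ℝ, W = hA.eigenvectorUnitary := ⟨_, rfl⟩
  have hWW : W * Wᵀ = 1 := by
    simpa [hW, star_eq_conjTranspose] using Unitary.coe_mul_star_self hA.eigenvectorUnitary
  have hspec : A = W * diagonal hA.eigenvalues * Wᵀ := by
    conv_lhs => rw [hA.spectral_theorem]
    rw [Unitary.conjStarAlgAut_apply, ← hW, star_eq_conjTranspose,
      conjTranspose_eq_transpose_of_trivial]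
    rfl
  have hnorm : x ⬝ᵥ x = ∑ k, (Wᵀ *ᵥ x) k * (Wᵀ *ᵥ x) k := by
    change _ = (Wᵀ *ᵥ x) ⬝ᵥ (Wᵀ *ᵥ x)
    rw [mulVec_transpose, ← dotProduct_mulVec, ← mulVec_transpose, mulVec_mulVec, hWW, one_mulVec]
  have hquad : x ⬝ᵥ A *ᵥ x
      = ∑ k, hA.eigenvalues k * ((Wᵀ *ᵥ x) k * (Wᵀ *ᵥ x) k) := by
    conv_lhs => rw [hspec, ← mulVec_mulVec, ← mulVec_mulVec, dotProduct_mulVec, ← mulVec_transpose]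
    simp only [dotProduct, mulVec_diagonal]
    exact Finset.sum_congr rfl fun k _ => by ring
  rw [hquad, hnorm, Finset.mul_sum]
  exact Finset.sum_le_sum fun k _ => mul_le_mul_of_nonneg_right
    (le_ciSup (Set.finite_range _).bddAbove k) (mul_self_nonneg _)

/-- Bessel's inequality for the Hilbert–Schmidt inner product on Hermitian matrices. -/
lemma sum_sq_trace_mul_le {n ι : Type*} [Fintype n] [Fintype ι] [DecidableEq ι]
    {X : Matrix n n ℂ} (hX : X.IsHermitian) (B : ι → Matrix n n ℂ)
    (hB : ∀ a, (B a).IsHermitian) {c : ℝ} (hc : 0 < c)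
    (horth : ∀ a b, (B a * B b).trace = if a = b then (c : ℂ) else 0) :
    ∑ a, (X * B a).trace.re ^ 2 ≤ c * (Xᴴ * X).trace.re := by
  set t : ι → ℝ := fun a => (X * B a).trace.re with ht
  set Y : Matrix n n ℂ := ∑ a, ((t a / c : ℝ) : ℂ) • B a with hY
  have hYh : Y.IsHermitian := by
    simp only [IsHermitian, hY, conjTranspose_sum, conjTranspose_smul, (hB _).eq]
    simp
  have hXY : (X * Y).trace.re = (∑ a, t a ^ 2) / c := by
    simp only [hY, Finset.mul_sum, trace_sum, mul_smul_comm, trace_smul, Complex.re_sum,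
      smul_eq_mul, Complex.re_ofReal_mul, Finset.sum_div]
    exact Finset.sum_congr rfl fun a _ => by simp only [ht]; ring
  have hYY : (Y * Y).trace.re = (∑ a, t a ^ 2) / c := by
    simp only [hY, Finset.mul_sum, Finset.sum_mul, trace_sum, mul_smul_comm, smul_mul_assoc,
      trace_smul, Complex.re_sum, smul_eq_mul, Complex.re_ofReal_mul, horth, Finset.sum_div]
    refine Finset.sum_congr rfl fun a _ => ?_
    rw [Finset.sum_eq_single a (fun b _ hb => by simp [hb]) (by simp)]
    simp
    field_simp
  have hpos : 0 ≤ ((X - Y)ᴴ * (X - Y)).trace.re :=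
    (Complex.le_def.mp (posSemidef_conjTranspose_mul_self (X - Y)).trace_nonneg).1
  rw [(hX.sub hYh).eq, sub_mul, mul_sub, mul_sub, trace_sub, trace_sub, trace_sub,
    trace_mul_comm Y X, Complex.sub_re, Complex.sub_re, Complex.sub_re, hXY, hYY] at hpos
  rw [hX.eq]
  have : (∑ a, t a ^ 2) / c ≤ (X * X).trace.re := by linarith
  rwa [div_le_iff₀' hc] at this

/-- An RU unitary on `ℂ²` is `n · σ` for a real unit vector `n`. -/
lemma IsRU.exists_eq_sum_pauli {U : Matrix (Fin 2) (Fin 2) ℂ} (hU : IsRU U) :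
    ∃ n : Fin 3 → ℝ, n ⬝ᵥ n = 1 ∧ U = ∑ i, (n i : ℂ) • pauli i := by
  obtain ⟨V, hV, rfl⟩ := hU
  have hD : (diagonal fun k : Fin 2 =>
      Complex.exp (2 * Real.pi * Complex.I * (((k : ℕ) : ℂ) + 1) / ((2 : ℕ) : ℂ)))
      = diagonal ![-1, 1] := by
    congr 1
    ext k
    fin_cases k
    · simp only [Fin.zero_eta, Nat.cast_zero, zero_add, mul_one, Nat.cast_ofNat, cons_val_zero]
      rw [← Complex.exp_pi_mul_I]
      congr 1
      ring
    · simp only [Fin.mk_one, Nat.cast_ofNat, cons_val_one, cons_val_fin_one]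
      rw [← Complex.exp_two_pi_mul_I]
      congr 1
      norm_num
  rw [hD]
  set D : Matrix (Fin 2) (Fin 2) ℂ := diagonal ![-1, 1] with hDdef
  have hVV : Vᴴ * V = 1 := (mem_unitaryGroup_iff'.mp hV)
  have hVV' : V * Vᴴ = 1 := (mem_unitaryGroup_iff.mp hV)
  have hDD : D * D = 1 := by
    rw [hDdef, diagonal_mul_diagonal, ← diagonal_one]
    congr 1
    ext k
    fin_cases k <;> simp
  have hDh : Dᴴ = D := by
    rw [hDdef, diagonal_conjTranspose]
    congr 1
    ext k
    fin_cases k <;> simp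
  obtain ⟨U, hU⟩ : ∃ U, U = V * D * Vᴴ := ⟨_, rfl⟩
  have hUh : Uᴴ = U := by
    rw [hU, conjTranspose_mul, conjTranspose_mul, conjTranspose_conjTranspose, hDh, mul_assoc]
  have hUU : U * U = 1 := by
    calc U * U = V * (D * (Vᴴ * V) * D) * Vᴴ := by rw [hU]; noncomm_ring
      _ = 1 := by rw [hVV, mul_one, hDD, mul_one, hVV']
  have hUt : U.trace = 0 := by
    rw [hU, trace_mul_comm, ← mul_assoc, hVV, one_mul, hDdef, trace_diagonal]
    simp
  rw [← hU]
  have h00 := congr_fun₂ hUh 0 0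
  have h01 := congr_fun₂ hUh 0 1
  have hsq := congr_fun₂ hUU 0 0
  simp only [conjTranspose_apply, Complex.star_def] at h00 h01
  simp only [mul_apply, Fin.sum_univ_two, one_apply_eq, ← h01] at hsq
  rw [trace_fin_two] at hUt
  have h00i : (U 0 0).im = 0 := Complex.conj_eq_iff_im.mp h00
  refine ⟨![(U 1 0).re, (U 1 0).im, (U 0 0).re], ?_, ?_⟩
  · have := congr_arg Complex.re hsq
    simp [h00i] at this
    simp [dotProduct, Fin.sum_univ_three]
    linarith
  · have h11 : U 1 1 = - U 0 0 := by linear_combination hUt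
    ext i j
    fin_cases i <;> fin_cases j <;>
      simp [Fin.sum_univ_three, pauli, Complex.ext_iff, ← h01, h11, h00i]

lemma trace_pauli_mul_pauli (i j : Fin 3) :
    (pauli i * pauli j).trace = if i = j then 2 else 0 := by
  fin_cases i <;> fin_cases j <;> simp [pauli, trace_fin_two] <;> norm_num

/-- Conjugation by `n · σ` rotates the Bloch vector by `π` around `n`. -/
lemma sum_pauli_mul_pauli_mul_sum_pauli {n : Fin 3 → ℝ} (hn : n ⬝ᵥ n = 1) (i : Fin 3) :
    (∑ k, (n k : ℂ) • pauli k) * pauli i * (∑ k, (n k : ℂ) • pauli k)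
      = (2 * n i : ℂ) • (∑ k, (n k : ℂ) • pauli k) - pauli i := by
  have h : (n 0 : ℂ) * n 0 + n 1 * n 1 + n 2 * n 2 = 1 := by
    simp only [dotProduct, Fin.sum_univ_three] at hn
    exact_mod_cast hn
  have hI := Complex.I_sq
  ext a b
  fin_cases i <;> fin_cases a <;> fin_cases b <;>
    simp [pauli, Fin.sum_univ_three, mul_apply, Fin.sum_univ_two] <;> grind

lemma sum_pauli_isHermitian (n : Fin 3 → ℝ) : (∑ k, (n k : ℂ) • pauli k).IsHermitian := by
  simp only [IsHermitian, conjTranspose_sum, conjTranspose_smul, (pauli_isHermitian _).eq]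
  simp

/-- The correlations of `ρ - (U ⊗ I) ρ (U ⊗ I)†`, for `U = n · σ`, are twice the component of the
correlation matrix of `ρ` orthogonal to `n`. -/
lemma trace_sub_conjA_mul_re {N : ℕ} (hN : 0 < N)
    (ρ : Matrix (Fin 2 × Fin N) (Fin 2 × Fin N) ℂ)
    (σB : Fin (N ^ 2 - 1) → Matrix (Fin N) (Fin N) ℂ) {n : Fin 3 → ℝ} (hn : n ⬝ᵥ n = 1)
    (i : Fin 3) (j : Fin (N ^ 2 - 1)) :
    (((ρ - conjA (∑ k, (n k : ℂ) • pauli k) ρ) * (pauli i ⊗ₖ σB j)).trace).re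
      = 4 / N * (corrT ρ σB i j - n i * ∑ k, n k * corrT ρ σB k j) := by
  set U := ∑ k, (n k : ℂ) • pauli k with hU
  have hconj : (conjA U ρ * (pauli i ⊗ₖ σB j)).trace
      = (ρ * ((U * pauli i * U) ⊗ₖ σB j)).trace := by
    rw [conjA, conjTranspose_kronecker, (sum_pauli_isHermitian n).eq, conjTranspose_one,
      mul_assoc, mul_assoc, trace_mul_comm, mul_assoc, ← hU]
    simp only [← mul_kronecker_mul, one_mul, mul_one, mul_assoc]
  have hlin : (ρ * (U ⊗ₖ σB j)).trace = ∑ k, (n k : ℂ) * (ρ * (pauli k ⊗ₖ σB j)).trace := by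
    simp only [hU, Fin.sum_univ_three, add_kronecker, smul_kronecker, mul_add, trace_add,
      mul_smul_comm, trace_smul, smul_eq_mul]
  have hkron : (U * pauli i * U) ⊗ₖ σB j
      = (2 * n i : ℂ) • (U ⊗ₖ σB j) - pauli i ⊗ₖ σB j := by
    rw [hU, sum_pauli_mul_pauli_mul_sum_pauli hn, sub_eq_add_neg, add_kronecker, smul_kronecker,
      ← neg_one_smul ℂ, smul_kronecker, neg_one_smul, ← sub_eq_add_neg]
  have hN' : (N : ℝ) ≠ 0 := by positivity
  rw [sub_mul, trace_sub, hconj, hkron, mul_sub, trace_sub, mul_smul_comm, trace_smul, hlin]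
  simp only [corrT, of_apply, Complex.sub_re, smul_eq_mul, Fin.sum_univ_three,
    Complex.add_re, Complex.mul_re, Complex.mul_im, Complex.add_im, Complex.ofReal_re,
    Complex.ofReal_im, Complex.re_ofNat, Complex.im_ofNat]
  field_simp
  ring

/-- The squared norm of the component of the columns of `T` orthogonal to a unit vector `n`. -/
lemma sum_sq_sub_proj {p q : ℕ} (T : Matrix (Fin p) (Fin q) ℝ) {n : Fin p → ℝ}
    (hn : n ⬝ᵥ n = 1) :
    ∑ i, ∑ j, (T i j - n i * ∑ k, n k * T k j) ^ 2
      = (∑ i, ∑ j, T i j ^ 2) - n ⬝ᵥ (T * Tᵀ) *ᵥ n := by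
  have hquad : n ⬝ᵥ (T * Tᵀ) *ᵥ n = ∑ j, (∑ k, n k * T k j) ^ 2 := by
    rw [← mulVec_mulVec, dotProduct_mulVec, mulVec_transpose]
    simp only [dotProduct, vecMul, sq]
  rw [hquad, Finset.sum_comm, Finset.sum_comm (f := fun i j => T i j ^ 2),
    ← Finset.sum_sub_distrib]
  refine Finset.sum_congr rfl fun j _ => ?_
  set s := ∑ k, n k * T k j with hs
  have h : ∀ i, (T i j - n i * s) ^ 2 = T i j ^ 2 - 2 * s * (n i * T i j) + s ^ 2 * (n i * n i) :=
    fun i => by ring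
  simp only [h, Finset.sum_add_distrib, Finset.sum_sub_distrib, ← Finset.mul_sum, ← hs]
  change _ - _ + s ^ 2 * (n ⬝ᵥ n) = _
  rw [hn]
  ring

/-- Lower bound: `D(ρ) ≥ (√2/N)·√(Σ T_{ij}² − λ_max(T Tᵀ))`. -/
theorem D_ge_corr_bound {N : ℕ} (hN : 0 < N)
    (ρ : Matrix (Fin 2 × Fin N) (Fin 2 × Fin N) ℂ) (hρ : IsState ρ)
    (σB : Fin (N ^ 2 - 1) → Matrix (Fin N) (Fin N) ℂ)
    (hherm : ∀ j, (σB j).IsHermitian)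
    (htrace : ∀ j, (σB j).trace = 0)
    (horth : ∀ i j, (σB i * σB j).trace = if i = j then 2 else 0) :
    Dm ρ ≥ (Real.sqrt 2 / N) * Real.sqrt
      ((∑ i, ∑ j, corrT ρ σB i j ^ 2)
        - ⨆ k, (real_isHermitian_mul_transpose_self (corrT ρ σB)).eigenvalues k) := by
  refine le_csInf ⟨_, _, ⟨1, one_mem _, rfl⟩, rfl⟩ ?_
  rintro d ⟨U, hU, rfl⟩
  obtain ⟨n, hn, rfl⟩ := hU.exists_eq_sum_pauli
  set U := ∑ k, (n k : ℂ) • pauli k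
  set T := corrT ρ σB with hT
  set X := ρ - conjA U ρ with hX
  have hXh : X.IsHermitian := hρ.1.isHermitian.sub
    (isHermitian_mul_mul_conjTranspose _ hρ.1.isHermitian)
  have hbessel := sum_sq_trace_mul_le hXh
    (fun a : Fin 3 × Fin (N ^ 2 - 1) => pauli a.1 ⊗ₖ σB a.2)
    (fun a => by
      rw [IsHermitian, conjTranspose_kronecker, (pauli_isHermitian _).eq, (hherm _).eq])
    (c := 4) (by norm_num)
    (fun a b => by
      rw [← mul_kronecker_mul, trace_kronecker, trace_pauli_mul_pauli, horth]
      by_cases h1 : a.1 = b.1 <;> by_cases h2 : a.2 = b.2 <;> simp [h1, h2, Prod.ext_iff]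
      norm_num)
  have hray := dotProduct_mulVec_le_iSup_eigenvalues (real_isHermitian_mul_transpose_self T) n
  rw [hn, mul_one] at hray
  have hN' : (0 : ℝ) < N := by exact_mod_cast hN
  simp only [Fintype.sum_prod_type, hX, trace_sub_conjA_mul_re hN ρ σB hn, mul_pow,
    ← Finset.mul_sum, U] at hbessel
  rw [sum_sq_sub_proj _ hn, ← hT] at hbessel
  have hs : Real.sqrt 2 / N = 1 / Real.sqrt 2 * (2 / N) := by
    field_simp
    norm_num
  rw [DU, frob, hs, mul_assoc]
  refine mul_le_mul_of_nonneg_left ?_ (by positivity)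
  rw [← Real.sqrt_sq (show (0 : ℝ) ≤ 2 / N by positivity), ← Real.sqrt_mul (by positivity)]
  refine Real.sqrt_le_sqrt ?_
  calc _ ≤ (2 / N : ℝ) ^ 2 * ((∑ i, ∑ j, T i j ^ 2) - n ⬝ᵥ (T * Tᵀ) *ᵥ n) := by gcongr
    _ = ((4 / N) ^ 2 * ((∑ i, ∑ j, T i j ^ 2) - n ⬝ᵥ (T * Tᵀ) *ᵥ n)) / 4 := by ring
    _ ≤ _ := by
      rw [div_le_iff₀' (by norm_num)]
      exact hbessel

end
end

section
/- Let ρ be a two-qubit quantum state (on ℂ² ⊗ ℂ²) with correlation matrix T ∈ ℝ^{3×3} given by T_{ij} = tr(ρ (σ_i ⊗ σ_j)) for Pauli matrices σ_1,σ_2,σ_3, and let M(ρ) := λ_1(TᵀT) + λ_2(TᵀT) be the sum of the two largest eigenvalues of TᵀT. If D(ρ) > 1/√2, then M(ρ) > 1 (and hence ρ violates the CHSH inequality). -/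
open Matrix Kronecker BigOperators ComplexOrder

noncomputable section

/-- Two-qubit correlation matrix `T_{ij} = tr(ρ (σ_i ⊗ σ_j))`. -/
def corr2 (ρ : Matrix (Fin 2 × Fin 2) (Fin 2 × Fin 2) ℂ) : Matrix (Fin 3) (Fin 3) ℝ :=
  Matrix.of fun i j => (Matrix.trace (ρ * (pauli i ⊗ₖ pauli j))).re

lemma real_isHermitian_transpose_mul_self {n m : ℕ} (T : Matrix (Fin n) (Fin m) ℝ) :
    (Tᵀ * T).IsHermitian := by
  ext i j
  simp only [Matrix.conjTranspose_apply, Matrix.mul_apply, Matrix.transpose_apply, star_trivial]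
  exact Finset.sum_congr rfl fun k _ => mul_comm _ _

/-- `M(ρ) = λ₁(TᵀT) + λ₂(TᵀT)`: the sum of the two largest eigenvalues of `TᵀT`,
expressed as the largest sum of two eigenvalues at distinct indices. -/
def Mval (ρ : Matrix (Fin 2 × Fin 2) (Fin 2 × Fin 2) ℂ) : ℝ :=
  sSup {x : ℝ | ∃ i j : Fin 3, i ≠ j ∧
    x = (real_isHermitian_transpose_mul_self (corr2 ρ)).eigenvalues i +
        (real_isHermitian_transpose_mul_self (corr2 ρ)).eigenvalues j}

/-- Rayleigh bound: a lower bound on the eigenvalues bounds the quadratic form below. -/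
lemma Matrix.IsHermitian.mul_dotProduct_self_le {n : Type*} [Fintype n] [DecidableEq n]
    {A : Matrix n n ℝ} (hA : A.IsHermitian) {c : ℝ} (hc : ∀ i, c ≤ hA.eigenvalues i)
    (v : n → ℝ) : c * (v ⬝ᵥ v) ≤ v ⬝ᵥ A *ᵥ v := by
  have hpsd : (A - c • (1 : Matrix n n ℝ)).PosSemidef := by
    have hdiag : (diagonal fun i => hA.eigenvalues i - c).PosSemidef :=
      PosSemidef.diagonal fun i => sub_nonneg.mpr (hc i)
    have hconj := hdiag.mul_mul_conjTranspose_same (hA.eigenvectorUnitary : Matrix n n ℝ)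
    convert hconj using 1
    have hU : (hA.eigenvectorUnitary : Matrix n n ℝ) * (hA.eigenvectorUnitary : Matrix n n ℝ)ᴴ = 1 :=
      Unitary.coe_mul_star_self hA.eigenvectorUnitary
    have hspec := hA.spectral_theorem
    rw [Unitary.conjStarAlgAut_apply] at hspec
    have hd : (diagonal fun i => hA.eigenvalues i - c)
        = diagonal (RCLike.ofReal ∘ hA.eigenvalues) - c • (1 : Matrix n n ℝ) := by
      ext i j
      by_cases hij : i = j
      · subst hij; simp
      · simp [hij]
    rw [hd, mul_sub, sub_mul, mul_smul_comm, smul_mul_assoc, mul_one, hU]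
    congr 1
  have h0 := hpsd.dotProduct_mulVec_nonneg v
  simp only [star_trivial, sub_mulVec, smul_mulVec, one_mulVec, dotProduct_sub,
    dotProduct_smul, smul_eq_mul] at h0
  linarith

/-- For a real `3 × 3` matrix, the trace of `TᵀT` minus the Rayleigh quotient of `TTᵀ` at a unit
vector is at most a sum of two eigenvalues of `TᵀT`. -/
lemma exists_trace_sub_le_eigenvalues_add (T : Matrix (Fin 3) (Fin 3) ℝ) (v : Fin 3 → ℝ)
    (hv : v ⬝ᵥ v = 1) :
    ∃ i j : Fin 3, i ≠ j ∧ (T * Tᵀ).trace - v ⬝ᵥ (T * Tᵀ) *ᵥ v ≤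
      (real_isHermitian_transpose_mul_self T).eigenvalues i +
        (real_isHermitian_transpose_mul_self T).eigenvalues j := by
  have hB : (T * Tᵀ).IsHermitian := by
    simpa using real_isHermitian_transpose_mul_self Tᵀ
  have heig : (real_isHermitian_transpose_mul_self T).eigenvalues = hB.eigenvalues :=
    (IsHermitian.eigenvalues_eq_eigenvalues_iff _ _).mpr (charpoly_mul_comm _ _)
  rw [heig, hB.trace_eq_sum_eigenvalues, Fin.sum_univ_three]
  obtain ⟨k, hk⟩ := Finite.exists_min hB.eigenvalues
  have hray := hB.mul_dotProduct_self_le hk v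
  rw [hv, mul_one] at hray
  simp only [RCLike.ofReal_real_eq_id, id_eq]
  fin_cases k
  · exact ⟨1, 2, by decide, by simp at hray; linarith⟩
  · exact ⟨0, 2, by decide, by simp at hray; linarith⟩
  · exact ⟨0, 1, by decide, by simp at hray; linarith⟩

lemma eigenvalues_add_le_Mval (ρ : Matrix (Fin 2 × Fin 2) (Fin 2 × Fin 2) ℂ) {i j : Fin 3}
    (hij : i ≠ j) : (real_isHermitian_transpose_mul_self (corr2 ρ)).eigenvalues i +
        (real_isHermitian_transpose_mul_self (corr2 ρ)).eigenvalues j ≤ Mval ρ := by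
  refine le_csSup (Set.Finite.bddAbove ?_) ⟨i, j, hij, rfl⟩
  refine (Set.finite_range fun p : Fin 3 × Fin 3 =>
    (real_isHermitian_transpose_mul_self (corr2 ρ)).eigenvalues p.1 +
      (real_isHermitian_transpose_mul_self (corr2 ρ)).eigenvalues p.2).subset ?_
  rintro x ⟨a, b, -, rfl⟩
  exact ⟨(a, b), rfl⟩

/-- A Hermitian `2 × 2` matrix commutes with some RU unitary, which is a Hermitian traceless
involution. -/
lemma exists_isRU_commute (R : Matrix (Fin 2) (Fin 2) ℂ) (hR : R.IsHermitian) :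
    ∃ U, IsRU U ∧ Uᴴ = U ∧ U * U = 1 ∧ U.trace = 0 ∧ U * R = R * U := by
  set V : Matrix (Fin 2) (Fin 2) ℂ := hR.eigenvectorUnitary.1
  have hVV : Vᴴ * V = 1 := Unitary.coe_star_mul_self hR.eigenvectorUnitary
  have hVV' : V * Vᴴ = 1 := Unitary.coe_mul_star_self hR.eigenvectorUnitary
  have hspec : R = V * diagonal (RCLike.ofReal ∘ hR.eigenvalues) * Vᴴ := by
    conv_lhs => rw [hR.spectral_theorem, Unitary.conjStarAlgAut_apply]
    rfl
  set e : Fin 2 → ℂ := ![-1, 1] with he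
  have hexp : (fun k : Fin 2 =>
      Complex.exp (2 * Real.pi * Complex.I * (((k : ℕ) : ℂ) + 1) / ((2 : ℕ) : ℂ))) = e := by
    funext k
    fin_cases k
    · have : (2 * Real.pi * Complex.I * (((0 : ℕ) : ℂ) + 1) / ((2 : ℕ) : ℂ))
          = Real.pi * Complex.I := by push_cast; ring
      simpa [he, Complex.exp_pi_mul_I] using congrArg Complex.exp this
    · have : (2 * Real.pi * Complex.I * (((1 : ℕ) : ℂ) + 1) / ((2 : ℕ) : ℂ))
          = 2 * Real.pi * Complex.I := by push_cast; ring
      simpa [he, Complex.exp_two_pi_mul_I] using congrArg Complex.exp this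
  have hmul : ∀ f g : Fin 2 → ℂ, (V * diagonal f * Vᴴ) * (V * diagonal g * Vᴴ)
      = V * diagonal (fun i => f i * g i) * Vᴴ := by
    intro f g
    calc _ = V * diagonal f * (Vᴴ * V) * diagonal g * Vᴴ := by simp only [Matrix.mul_assoc]
      _ = _ := by rw [hVV, Matrix.mul_one, Matrix.mul_assoc V, diagonal_mul_diagonal]
  refine ⟨V * diagonal e * Vᴴ, ⟨V, hR.eigenvectorUnitary.2, by rw [hexp]⟩, ?_, ?_, ?_, ?_⟩
  · rw [conjTranspose_mul, conjTranspose_mul, conjTranspose_conjTranspose,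
      diagonal_conjTranspose, Matrix.mul_assoc]
    congr 3
    funext i
    fin_cases i <;> simp [he]
  · have : (fun i => e i * e i) = fun _ => 1 := by
      funext i
      fin_cases i <;> simp [he]
    rw [hmul, this, diagonal_one, Matrix.mul_one, hVV']
  · rw [Matrix.trace_mul_comm, ← Matrix.mul_assoc, hVV, Matrix.one_mul, trace_diagonal]
    simp [he]
  · rw [hspec, hmul, hmul]
    simp only [mul_comm]

/-- A Hermitian traceless `2 × 2` involution is `n · σ` for a real unit vector `n = (a, b, c)`. -/
lemma exists_bloch_of_involution {U : Matrix (Fin 2) (Fin 2) ℂ} (hH : Uᴴ = U) (hI : U * U = 1)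
    (hT : U.trace = 0) : ∃ a b c : ℝ, a ^ 2 + b ^ 2 + c ^ 2 = 1 ∧
      U = !![(c : ℂ), a - b * Complex.I; a + b * Complex.I, -c] := by
  have h00 := congrFun₂ hH 0 0
  have h01 := congrFun₂ hH 0 1
  have hsq := congrFun₂ hI 0 0
  simp only [conjTranspose_apply, mul_apply, Fin.sum_univ_two, one_apply_eq, trace, diag_apply]
    at h00 h01 hsq hT
  have him : (U 0 0).im = 0 := by
    have := congrArg Complex.im h00
    simp at this
    linarith
  have hU00 : U 0 0 = ((U 0 0).re : ℂ) := Complex.ext (by simp) (by simp [him])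
  have hU10 : U 1 0 = (U 1 0).re + (U 1 0).im * Complex.I := (Complex.re_add_im _).symm
  refine ⟨(U 1 0).re, (U 1 0).im, (U 0 0).re, ?_, ?_⟩
  · rw [← h01] at hsq
    have := congrArg Complex.re hsq
    simp [him] at this
    linarith
  · ext i j
    fin_cases i <;> fin_cases j
    · exact hU00
    · change U 0 1 = _
      rw [← h01]
      apply Complex.ext <;> simp
    · exact hU10
    · change U 1 1 = -((U 0 0).re : ℂ)
      rw [← hU00]
      exact eq_neg_of_add_eq_zero_right hT

/-- Expansion of `‖ρ − KρK‖_F²` for Hermitian `ρ` and a Hermitian involution `K = U ⊗ I`. -/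
lemma DU_eq_of_involution {M N : ℕ} {ρ : Matrix (Fin M × Fin N) (Fin M × Fin N) ℂ}
    (hρ : ρ.IsHermitian) {U : Matrix (Fin M) (Fin M) ℂ} (hH : Uᴴ = U) (hI : U * U = 1) :
    DU ρ U = 1 / √2 * √(2 * ((ρ * ρ).trace.re -
      (ρ * (U ⊗ₖ (1 : Matrix (Fin N) (Fin N) ℂ)) * ρ *
        (U ⊗ₖ (1 : Matrix (Fin N) (Fin N) ℂ))).trace.re)) := by
  set K := U ⊗ₖ (1 : Matrix (Fin N) (Fin N) ℂ) with hK
  have hKH : Kᴴ = K := by rw [hK, conjTranspose_kronecker, hH, conjTranspose_one]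
  have hKK : K * K = 1 := by rw [hK, ← mul_kronecker_mul, hI, Matrix.mul_one, one_kronecker_one]
  unfold DU frob conjA
  rw [← hK, hKH, conjTranspose_sub, conjTranspose_mul, conjTranspose_mul, hKH, hρ.eq,
    ← Complex.sub_re]
  congr 2
  have hexp : (ρ - K * (ρ * K)) * (ρ - K * ρ * K)
      = ρ * ρ - ρ * K * ρ * K - K * (ρ * K * ρ) + K * (ρ * ρ * K) := by
    have h1 : K * (ρ * K) * (K * ρ * K) = K * (ρ * ρ * K) := by
      calc _ = K * ρ * (K * K) * ρ * K := by simp only [Matrix.mul_assoc]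
        _ = _ := by rw [hKK]; simp only [Matrix.mul_assoc, Matrix.one_mul]
    rw [sub_mul, mul_sub, mul_sub, h1]
    simp only [Matrix.mul_assoc]
    abel
  have htr : (K * (ρ * ρ * K)).trace = (ρ * ρ).trace := by
    rw [Matrix.trace_mul_comm, Matrix.mul_assoc, hKK, Matrix.mul_one]
  rw [hexp, trace_add, trace_sub, trace_sub, htr, Matrix.trace_mul_comm K (ρ * K * ρ)]
  simp only [Complex.add_re, Complex.sub_re]
  ring

/-- Pauli expansion of the purity loss, with the local Bloch vector of the first qubit read off
from the partial trace. -/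
lemma purity_sub_eq {ρ : Matrix (Fin 2 × Fin 2) (Fin 2 × Fin 2) ℂ} (hρ : ρ.IsHermitian)
    (a b c : ℝ) :
    2 * ((a ^ 2 + b ^ 2 + c ^ 2) * (ρ * ρ).trace.re -
      (ρ * (!![(c : ℂ), a - b * Complex.I; a + b * Complex.I, -c] ⊗ₖ
          (1 : Matrix (Fin 2) (Fin 2) ℂ)) * ρ *
        (!![(c : ℂ), a - b * Complex.I; a + b * Complex.I, -c] ⊗ₖ
          (1 : Matrix (Fin 2) (Fin 2) ℂ))).trace.re) =
      (2 * b * (traceB ρ 0 1).re + 2 * a * (traceB ρ 0 1).im) ^ 2 +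
      (2 * c * (traceB ρ 0 1).re - a * ((traceB ρ 0 0).re - (traceB ρ 1 1).re)) ^ 2 +
      (2 * c * (traceB ρ 0 1).im + b * ((traceB ρ 0 0).re - (traceB ρ 1 1).re)) ^ 2 +
      (a ^ 2 + b ^ 2 + c ^ 2) * (corr2 ρ * (corr2 ρ)ᵀ).trace -
      ![a, b, c] ⬝ᵥ (corr2 ρ * (corr2 ρ)ᵀ) *ᵥ ![a, b, c] := by
  have hd (p) : (ρ p p).im = 0 := by
    have := congrArg Complex.im (hρ.apply p p)
    simp at this
    linarith
  have hlow (p q) : ρ p q = (starRingEnd ℂ) (ρ q p) := (hρ.apply p q).symm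
  have h1 := hlow (0, 1) (0, 0)
  have h2 := hlow (1, 0) (0, 0)
  have h3 := hlow (1, 1) (0, 0)
  have h4 := hlow (1, 0) (0, 1)
  have h5 := hlow (1, 1) (0, 1)
  have h6 := hlow (1, 1) (1, 0)
  have hq : ![a, b, c] ⬝ᵥ (corr2 ρ * (corr2 ρ)ᵀ) *ᵥ ![a, b, c] =
      ∑ j, (a * corr2 ρ 0 j + b * corr2 ρ 1 j + c * corr2 ρ 2 j) ^ 2 := by
    simp [dotProduct, mulVec, mul_apply, Fin.sum_univ_three]
    ring
  have ht : (corr2 ρ * (corr2 ρ)ᵀ).trace = ∑ i, ∑ j, corr2 ρ i j ^ 2 := by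
    simp [trace, mul_apply, sq]
  rw [hq, ht]
  simp only [corr2, pauli, traceB, trace, diag_apply, mul_apply, Fintype.sum_prod_type,
    Fin.sum_univ_two, Fin.sum_univ_three, kroneckerMap_apply, of_apply, one_apply, cons_val,
    cons_val', h1, h2, h3, h4, h5, h6]
  simp [hd]
  ring

/-- For a two-qubit state `ρ`, if `D(ρ) > 1/√2` then `M(ρ) > 1`
(and hence `ρ` violates the CHSH inequality). -/
theorem Mval_gt_one_of_D_gt (ρ : Matrix (Fin 2 × Fin 2) (Fin 2 × Fin 2) ℂ)
    (hρ : IsState ρ) (h : 1 / Real.sqrt 2 < Dm ρ) : 1 < Mval ρ := by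
  have hherm : ρ.IsHermitian := hρ.1.isHermitian
  have hR : (traceB ρ).IsHermitian := by
    ext i j
    simp only [conjTranspose_apply, traceB, of_apply, star_sum]
    exact Finset.sum_congr rfl fun k _ => hherm.apply _ _
  obtain ⟨U, hRU, hH, hI, hT, hcomm⟩ := exists_isRU_commute _ hR
  obtain ⟨a, b, c, hn, rfl⟩ := exists_bloch_of_involution hH hI hT
  have hlt := h.trans_le (Dm_le_DU ρ hRU)
  rw [DU_eq_of_involution hherm hH hI] at hlt
  have hkey := purity_sub_eq hherm a b c
  rw [hn, one_mul, one_mul] at hkey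
  rw [hkey] at hlt
  have hlt' := lt_of_mul_lt_mul_left ((mul_one (1 / √2)).trans_lt hlt) (by positivity)
  rw [Real.lt_sqrt zero_le_one, one_pow] at hlt'
  have h10 : traceB ρ 1 0 = (starRingEnd ℂ) (traceB ρ 0 1) := (hR.apply 1 0).symm
  have e00 := congrFun₂ hcomm 0 0
  have e01 := congrFun₂ hcomm 0 1
  simp only [mul_apply, Fin.sum_univ_two, of_apply, cons_val', cons_val, h10] at e00 e01
  have i00 := congrArg Complex.im e00
  have r01 := congrArg Complex.re e01
  have i01 := congrArg Complex.im e01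
  have d0 : (traceB ρ 0 0).im = 0 := by
    have := congrArg Complex.im (hR.apply 0 0)
    simp at this
    linarith
  have d1 : (traceB ρ 1 1).im = 0 := by
    have := congrArg Complex.im (hR.apply 1 1)
    simp at this
    linarith
  simp [d0, d1] at i00 r01 i01
  have z1 : 2 * b * (traceB ρ 0 1).re + 2 * a * (traceB ρ 0 1).im = 0 := by linarith
  have z2 : 2 * c * (traceB ρ 0 1).re - a * ((traceB ρ 0 0).re - (traceB ρ 1 1).re) = 0 := by
    linarith
  have z3 : 2 * c * (traceB ρ 0 1).im + b * ((traceB ρ 0 0).re - (traceB ρ 1 1).re) = 0 := by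
    linarith
  rw [z1, z2, z3] at hlt'
  obtain ⟨i, j, hij, hle⟩ := exists_trace_sub_le_eigenvalues_add (corr2 ρ) ![a, b, c]
    (by simp [dotProduct, Fin.sum_univ_three]; linarith)
  have := eigenvalues_add_le_Mval ρ hij
  linarith

end
end

section
/- Let d ≥ 2 and 0 ≤ p ≤ 1, and let ρ be the Werner state on ℂ^d ⊗ ℂ^d, i.e., ρ = (2p/(d²+d))·P_s + (2(1−p)/(d²−d))·P_a, where P_s = (I+P)/2 and P_a = (I−P)/2 are the projectors onto the symmetric and antisymmetric subspaces and P = Σ_{i,j=1}^d |i⟩⟨j| ⊗ |j⟩⟨i| is the swap operator. Then D(ρ) = |2pd − d − 1| / (d² − 1). -/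
open Matrix Kronecker BigOperators ComplexOrder

noncomputable section

/-- The swap operator `P = Σ_{i,j} |i⟩⟨j| ⊗ |j⟩⟨i|` on `ℂ^d ⊗ ℂ^d`. -/
def swapOp (d : ℕ) : Matrix (Fin d × Fin d) (Fin d × Fin d) ℂ :=
  Matrix.of fun p q => if p.1 = q.2 ∧ p.2 = q.1 then 1 else 0

/-- The Werner state `ρ = (2p/(d²+d))·P_s + (2(1−p)/(d²−d))·P_a`, where
`P_s = (I+P)/2` and `P_a = (I−P)/2`. -/
def werner (d : ℕ) (p : ℝ) : Matrix (Fin d × Fin d) (Fin d × Fin d) ℂ :=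
  (2 * p / (d ^ 2 + d) : ℝ) • ((1 / 2 : ℝ) • ((1 : Matrix (Fin d × Fin d) (Fin d × Fin d) ℂ) + swapOp d)) +
  (2 * (1 - p) / (d ^ 2 - d) : ℝ) • ((1 / 2 : ℝ) • ((1 : Matrix (Fin d × Fin d) (Fin d × Fin d) ℂ) - swapOp d))

theorem conjTranspose_swapOp (d : ℕ) : (swapOp d)ᴴ = swapOp d := by
  ext ⟨i, j⟩ ⟨k, l⟩
  simp only [swapOp, conjTranspose_apply, of_apply, apply_ite star, star_one, star_zero]
  grind

theorem swapOp_mul_apply (d : ℕ) (A : Matrix (Fin d × Fin d) (Fin d × Fin d) ℂ)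
    (i j : Fin d) (q : Fin d × Fin d) : (swapOp d * A) (i, j) q = A (j, i) q := by
  rw [mul_apply, Finset.sum_eq_single (j, i)]
  · simp [swapOp]
  · rintro ⟨k, l⟩ - h
    have : ¬(i = l ∧ j = k) := fun ⟨h₁, h₂⟩ => h (by rw [h₁, h₂])
    simp [swapOp, this]
  · simp

theorem mul_swapOp_apply (d : ℕ) (A : Matrix (Fin d × Fin d) (Fin d × Fin d) ℂ)
    (q : Fin d × Fin d) (i j : Fin d) : (A * swapOp d) q (i, j) = A q (j, i) := by
  rw [mul_apply, Finset.sum_eq_single (j, i)]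
  · simp [swapOp]
  · rintro ⟨k, l⟩ - h
    have : ¬(k = j ∧ l = i) := fun ⟨h₁, h₂⟩ => h (by rw [h₁, h₂])
    simp [swapOp, this]
  · simp

theorem swapOp_mul_self (d : ℕ) : swapOp d * swapOp d = 1 := by
  ext ⟨i, j⟩ ⟨k, l⟩
  rw [swapOp_mul_apply]
  simp only [swapOp, of_apply, one_apply, Prod.mk.injEq]
  grind

/-- Conjugation by the swap operator exchanges the two tensor factors. -/
theorem swapOp_mul_kronecker_mul_swapOp (d : ℕ) (A B : Matrix (Fin d) (Fin d) ℂ) :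
    swapOp d * (A ⊗ₖ B) * swapOp d = B ⊗ₖ A := by
  ext ⟨i, j⟩ ⟨k, l⟩
  rw [mul_swapOp_apply, swapOp_mul_apply]
  simp [kroneckerMap_apply, mul_comm]

theorem frob_smul {n : Type*} [Fintype n] (c : ℝ) (A : Matrix n n ℂ) :
    frob (c • A) = |c| * frob A := by
  have h : (trace ((c • A)ᴴ * (c • A))).re = c ^ 2 * (trace (Aᴴ * A)).re := by
    simp [conjTranspose_smul, trace_smul, smul_mul, sq, mul_assoc]
  rw [frob, frob, h, Real.sqrt_mul (sq_nonneg c), Real.sqrt_sq_eq_abs]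

/-- Root-of-unity unitaries are unitary. -/
theorem IsRU.mul_conjTranspose_self {M : ℕ} {U : Matrix (Fin M) (Fin M) ℂ} (hU : IsRU U) :
    U * Uᴴ = 1 := by
  obtain ⟨V, hV, rfl⟩ := hU
  have h₁ : Vᴴ * V = 1 := Matrix.mem_unitaryGroup_iff'.mp hV
  have h₂ : V * Vᴴ = 1 := Matrix.mem_unitaryGroup_iff.mp hV
  set D : Matrix (Fin M) (Fin M) ℂ := diagonal fun k : Fin M =>
      Complex.exp (2 * Real.pi * Complex.I * (((k : ℕ) : ℂ) + 1) / (M : ℂ)) with hD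
  have hDD : D * Dᴴ = 1 := by
    rw [hD, diagonal_conjTranspose, diagonal_mul_diagonal, ← diagonal_one]
    congr 1
    funext k
    rw [Pi.star_apply, Complex.star_def, ← Complex.exp_conj, ← Complex.exp_add]
    have h2 : (starRingEnd ℂ) 2 = 2 := Complex.conj_ofNat 2
    simp [neg_div, h2]
  calc V * D * Vᴴ * (V * D * Vᴴ)ᴴ = V * D * (Vᴴ * V) * Dᴴ * Vᴴ := by
        simp only [conjTranspose_mul, conjTranspose_conjTranspose, Matrix.mul_assoc]
    _ = V * (D * Dᴴ) * Vᴴ := by rw [h₁, Matrix.mul_one, Matrix.mul_assoc V]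
    _ = 1 := by rw [hDD, Matrix.mul_one, h₂]

/-- Root-of-unity unitaries in dimension at least two are traceless. -/
theorem IsRU.trace_eq_zero {M : ℕ} (hM : 2 ≤ M) {U : Matrix (Fin M) (Fin M) ℂ} (hU : IsRU U) :
    trace U = 0 := by
  obtain ⟨V, hV, rfl⟩ := hU
  have h₁ : Vᴴ * V = 1 := Matrix.mem_unitaryGroup_iff'.mp hV
  rw [trace_mul_cycle, h₁, Matrix.one_mul, trace_diagonal]
  have hζ := Complex.isPrimitiveRoot_exp M (by lia)
  have hterm (k : Fin M) :
      Complex.exp (2 * Real.pi * Complex.I * (((k : ℕ) : ℂ) + 1) / (M : ℂ)) =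
        Complex.exp (2 * Real.pi * Complex.I / M) *
          Complex.exp (2 * Real.pi * Complex.I / M) ^ (k : ℕ) := by
    rw [← Complex.exp_nat_mul, ← Complex.exp_add]
    congr 1
    ring
  simp only [hterm]
  rw [← Finset.mul_sum,
    Fin.sum_univ_eq_sum_range (fun k => Complex.exp (2 * Real.pi * Complex.I / M) ^ k) M,
    hζ.geom_sum_eq_zero (by lia), mul_zero]

theorem exists_isRU (M : ℕ) : ∃ U : Matrix (Fin M) (Fin M) ℂ, IsRU U :=
  ⟨_, 1, one_mem _, rfl⟩

/-- Rotating the swap operator by a traceless unitary moves it by `√2 · d` in Frobenius norm. -/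
theorem frob_swapOp_sub_conjA {d : ℕ} {U : Matrix (Fin d) (Fin d) ℂ} (hU : U * Uᴴ = 1)
    (htr : trace U = 0) : frob (swapOp d - conjA U (swapOp d)) = Real.sqrt 2 * d := by
  set W : Matrix (Fin d × Fin d) (Fin d × Fin d) ℂ := U ⊗ₖ (1 : Matrix (Fin d) (Fin d) ℂ) with hW
  have hWH : Wᴴ = Uᴴ ⊗ₖ (1 : Matrix (Fin d) (Fin d) ℂ) := by
    rw [hW, conjTranspose_kronecker, conjTranspose_one]
  have hWW : Wᴴ * W = 1 := by
    rw [hWH, hW, ← mul_kronecker_mul, mul_eq_one_comm.mp hU, Matrix.one_mul, one_kronecker_one]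
  have hW' : W * Wᴴ = 1 := mul_eq_one_comm.mp hWW
  have hcross : trace (swapOp d * (W * swapOp d * Wᴴ)) = 0 := by
    rw [← Matrix.mul_assoc, ← Matrix.mul_assoc, hWH, hW, swapOp_mul_kronecker_mul_swapOp,
      ← mul_kronecker_mul, Matrix.one_mul, Matrix.mul_one, trace_kronecker, htr, mul_zero]
  have hherm : (W * swapOp d * Wᴴ)ᴴ = W * swapOp d * Wᴴ := by
    simp only [conjTranspose_mul, conjTranspose_conjTranspose, conjTranspose_swapOp,
      Matrix.mul_assoc]
  have hsq : W * swapOp d * Wᴴ * (W * swapOp d * Wᴴ) = 1 := by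
    calc W * swapOp d * Wᴴ * (W * swapOp d * Wᴴ)
        = W * swapOp d * (Wᴴ * W) * swapOp d * Wᴴ := by simp only [Matrix.mul_assoc]
      _ = W * (swapOp d * swapOp d) * Wᴴ := by rw [hWW, Matrix.mul_one, Matrix.mul_assoc W]
      _ = 1 := by rw [swapOp_mul_self, Matrix.mul_one, hW']
  have htrace : trace ((swapOp d - W * swapOp d * Wᴴ)ᴴ * (swapOp d - W * swapOp d * Wᴴ)) =
      ((2 * (d : ℝ) ^ 2 : ℝ) : ℂ) := by
    rw [conjTranspose_sub, hherm, conjTranspose_swapOp, Matrix.sub_mul, Matrix.mul_sub,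
      Matrix.mul_sub, hsq, swapOp_mul_self, trace_sub, trace_sub, trace_sub,
      trace_mul_comm (W * swapOp d * Wᴴ), hcross, trace_one]
    simp only [Fintype.card_prod, Fintype.card_fin]
    push_cast
    ring
  rw [conjA, ← hW, frob, htrace, Complex.ofReal_re, Real.sqrt_mul zero_le_two,
    Real.sqrt_sq d.cast_nonneg]

theorem werner_eq (d : ℕ) (p : ℝ) :
    werner d p =
      (p / (d ^ 2 + d) + (1 - p) / (d ^ 2 - d) : ℝ) • 1 +
        (p / (d ^ 2 + d) - (1 - p) / (d ^ 2 - d) : ℝ) • swapOp d := by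
  rw [werner]
  module

/-- The distance `D(ρ, U)` of a Werner state does not depend on the traceless unitary `U`. -/
theorem DU_werner {d : ℕ} (hd : 2 ≤ d) (p : ℝ) {U : Matrix (Fin d) (Fin d) ℂ}
    (hU : U * Uᴴ = 1) (htr : trace U = 0) :
    DU (werner d p) U = |2 * p * d - d - 1| / ((d : ℝ) ^ 2 - 1) := by
  have hone : conjA U (1 : Matrix (Fin d × Fin d) (Fin d × Fin d) ℂ) = 1 := by
    rw [conjA, Matrix.mul_one, conjTranspose_kronecker, conjTranspose_one, ← mul_kronecker_mul,
      hU, Matrix.one_mul, one_kronecker_one]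
  have hlin (a b : ℝ) : a • 1 + b • swapOp d - conjA U (a • 1 + b • swapOp d) =
      b • (swapOp d - conjA U (swapOp d)) := by
    have : conjA U (a • 1 + b • swapOp d) = a • conjA U 1 + b • conjA U (swapOp d) := by
      simp only [conjA, Matrix.mul_add, Matrix.add_mul, Matrix.mul_smul, Matrix.smul_mul]
    rw [this, hone]
    module
  have hd' : (2 : ℝ) ≤ d := by exact_mod_cast hd
  have hpos : 0 < (d : ℝ) ^ 2 - 1 := by nlinarith
  have hcoef : p / ((d : ℝ) ^ 2 + d) - (1 - p) / (d ^ 2 - d) =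
      (2 * p * d - d - 1) / (d * (d ^ 2 - 1)) := by
    have h₁ : (d : ℝ) ≠ 0 := by positivity
    have h₂ : (d : ℝ) + 1 ≠ 0 := by positivity
    have h₃ : (d : ℝ) - 1 ≠ 0 := by linarith
    rw [show (d : ℝ) ^ 2 + d = d * (d + 1) by ring, show (d : ℝ) ^ 2 - d = d * (d - 1) by ring,
      show (d : ℝ) ^ 2 - 1 = (d + 1) * (d - 1) by ring]
    field_simp
    ring
  rw [DU, werner_eq, hlin, frob_smul, frob_swapOp_sub_conjA hU htr, hcoef, abs_div,
    abs_of_pos (mul_pos (by linarith) hpos : 0 < (d : ℝ) * (d ^ 2 - 1))]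
  have h₂ : Real.sqrt 2 ≠ 0 := by positivity
  field_simp

/-- For the Werner state on `ℂ^d ⊗ ℂ^d` (`d ≥ 2`, `0 ≤ p ≤ 1`),
`D(ρ) = |2pd − d − 1| / (d² − 1)`. -/
theorem D_werner (d : ℕ) (hd : 2 ≤ d) (p : ℝ) (hp0 : 0 ≤ p) (hp1 : p ≤ 1) :
    Dm (werner d p) = |2 * p * d - d - 1| / ((d : ℝ) ^ 2 - 1) := by
  have hset : {x : ℝ | ∃ U, IsRU U ∧ x = DU (werner d p) U} =
      {|2 * p * d - d - 1| / ((d : ℝ) ^ 2 - 1)} := by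
    ext x
    constructor
    · rintro ⟨U, hU, rfl⟩
      exact DU_werner hd p hU.mul_conjTranspose_self (hU.trace_eq_zero hd)
    · rintro rfl
      obtain ⟨U, hU⟩ := exists_isRU d
      exact ⟨U, hU, (DU_werner hd p hU.mul_conjTranspose_self (hU.trace_eq_zero hd)).symm⟩
  rw [Dm, hset, csInf_singleton]

end
end

section
/- Let M ≥ 2 and let w ∈ ℝ^M. Suppose that for every permutation π of {1,…,M}, Σ_{k=1}^M w_k · e^{2πi·π(k)/M} = 0. Then all entries of w are equal, i.e., w_1 = w_2 = ⋯ = w_M. -/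
open BigOperators

theorem sum_mul_sub_sum_mul_swap {ι R : Type*} [Fintype ι] [DecidableEq ι] [CommRing R]
    (w f : ι → R) {i j : ι} (hij : i ≠ j) :
    ∑ k, w k * f k - ∑ k, w k * f (Equiv.swap i j k) = (w i - w j) * (f i - f j) := by
  rw [← Finset.sum_sub_distrib, Fintype.sum_eq_add i j hij]
  · rw [Equiv.swap_apply_left, Equiv.swap_apply_right]
    ring
  · rintro k ⟨hi, hj⟩
    rw [Equiv.swap_apply_of_ne_of_ne hi hj, sub_self]

theorem exp_two_pi_mul_I_succ_div_injective (M : ℕ) :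
    Function.Injective fun k : Fin M =>
      Complex.exp (2 * Real.pi * Complex.I * (((k : ℕ) : ℂ) + 1) / (M : ℂ)) := by
  intro k l hkl
  have hM : M ≠ 0 := k.pos.ne'
  have hζ := Complex.isPrimitiveRoot_exp M hM
  have hpow : ∀ j : ℕ, Complex.exp (2 * Real.pi * Complex.I * ((j : ℂ) + 1) / (M : ℂ)) =
      Complex.exp (2 * Real.pi * Complex.I / M) ^ j *
        Complex.exp (2 * Real.pi * Complex.I / M) := by
    intro j
    rw [← pow_succ, ← Complex.exp_nat_mul]
    congr 1
    push_cast
    ring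
  simp only [hpow] at hkl
  exact Fin.ext (hζ.pow_inj k.isLt l.isLt (mul_right_cancel₀ (Complex.exp_ne_zero _) hkl))

/-- Let `M ≥ 2` and `w ∈ ℝ^M`. If for every permutation `π` of
`{1,…,M}` we have `Σ_k w_k·e^{2πi·π(k)/M} = 0`, then all entries of `w` are equal. -/
theorem all_entries_equal_of_perm_sums_vanish (M : ℕ) (hM : 2 ≤ M) (w : Fin M → ℝ)
    (h : ∀ π : Equiv.Perm (Fin M),
      ∑ k, (w k : ℂ) *
        Complex.exp (2 * Real.pi * Complex.I * (((π k : ℕ) : ℂ) + 1) / (M : ℂ)) = 0) :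
    ∀ k l, w k = w l := by
  intro k l
  by_cases hkl : k = l
  · rw [hkl]
  have hswap := sum_mul_sub_sum_mul_swap (fun j => (w j : ℂ))
    (fun j : Fin M => Complex.exp (2 * Real.pi * Complex.I * (((j : ℕ) : ℂ) + 1) / (M : ℂ))) hkl
  have hid := h 1
  simp only [Equiv.Perm.one_apply] at hid
  rw [hid, h (Equiv.swap k l), sub_self] at hswap
  rcases mul_eq_zero.mp hswap.symm with hw | he
  · exact_mod_cast sub_eq_zero.mp hw
  · exact absurd (exp_two_pi_mul_I_succ_div_injective M (sub_eq_zero.mp he)) hkl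
end

section
/- Let ρ be a bipartite quantum state on ℂ^M ⊗ ℂ^N. Then D(ρ) = 0 if and only if there exists a complete family of rank-one orthogonal projectors {Π_j}_{j=1}^M on ℂ^M (i.e., Π_j Π_k = δ_{jk} Π_j, Σ_j Π_j = I_M, and each Π_j has rank one) such that ρ = Σ_{j=1}^M (Π_j ⊗ I_N) ρ (Π_j ⊗ I_N). (By Ollivier–Zurek, the latter condition is equivalent to ρ having zero quantum discord with respect to subsystem A; hence D is a faithful non-classicality measure.) -/
open Matrix Kronecker BigOperators ComplexOrder

noncomputable section

theorem isCompact_unitaryGroup (M : ℕ) :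
    IsCompact (Matrix.unitaryGroup (Fin M) ℂ : Set (Matrix (Fin M) (Fin M) ℂ)) := by
  have hK : IsCompact (Set.univ.pi fun _ : Fin M => Set.univ.pi fun _ : Fin M =>
      Metric.closedBall (0 : ℂ) 1) :=
    isCompact_univ_pi fun _ => isCompact_univ_pi fun _ => isCompact_closedBall _ _
  refine IsCompact.of_isClosed_subset (X := Matrix (Fin M) (Fin M) ℂ) hK
    (isClosed_unitary (R := Matrix (Fin M) (Fin M) ℂ)) fun U hU i _ j _ => ?_
  simpa using entry_norm_bound_of_unitary hU i j

theorem frob_eq_zero_iff {n : Type*} [Fintype n] (A : Matrix n n ℂ) : frob A = 0 ↔ A = 0 := by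
  have h : 0 ≤ (Aᴴ * A).trace := (Matrix.posSemidef_conjTranspose_mul_self A).trace_nonneg
  rw [frob, Real.sqrt_eq_zero (Complex.le_def.1 h).1,
    ← Matrix.trace_conjTranspose_mul_self_eq_zero_iff, Complex.ext_iff]
  simp [← (Complex.le_def.1 h).2]

theorem DU_nonneg {M N : ℕ} (ρ : Matrix (Fin M × Fin N) (Fin M × Fin N) ℂ)
    (U : Matrix (Fin M) (Fin M) ℂ) : 0 ≤ DU ρ U := by
  unfold DU frob
  positivity

theorem DU_eq_zero_iff {M N : ℕ} (ρ : Matrix (Fin M × Fin N) (Fin M × Fin N) ℂ)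
    (U : Matrix (Fin M) (Fin M) ℂ) : DU ρ U = 0 ↔ ρ = conjA U ρ := by
  rw [DU, mul_eq_zero, frob_eq_zero_iff, sub_eq_zero]
  simp

theorem continuous_DU {M N : ℕ} (ρ : Matrix (Fin M × Fin N) (Fin M × Fin N) ℂ) :
    Continuous (DU ρ) := by
  have hk : Continuous fun U : Matrix (Fin M) (Fin M) ℂ =>
      U ⊗ₖ (1 : Matrix (Fin N) (Fin N) ℂ) :=
    continuous_matrix fun i j => by
      simp only [kroneckerMap_apply]
      fun_prop
  have hd : Continuous fun U => ρ - conjA U ρ := by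
    unfold conjA
    fun_prop
  unfold DU frob
  fun_prop

/-- The `k`-th eigenvalue of a Root-of-Unity unitary. -/
def ruEigenvalue (M : ℕ) (k : Fin M) : ℂ :=
  Complex.exp (2 * Real.pi * Complex.I * (((k : ℕ) : ℂ) + 1) / (M : ℂ))

theorem ruEigenvalue_eq_pow (M : ℕ) (k : Fin M) :
    ruEigenvalue M k = Complex.exp (2 * Real.pi * Complex.I / M) ^ ((k : ℕ) + 1) := by
  rw [ruEigenvalue, ← Complex.exp_nat_mul]
  congr 1
  push_cast
  ring

theorem ruEigenvalue_injective (M : ℕ) : Function.Injective (ruEigenvalue M) := by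
  intro i j h
  have hM : M ≠ 0 := by have := i.2; omega
  simp only [ruEigenvalue_eq_pow, pow_succ] at h
  exact Fin.ext ((Complex.isPrimitiveRoot_exp M hM).pow_inj i.2 j.2
    (mul_right_cancel₀ (Complex.exp_ne_zero _) h))

theorem ruEigenvalue_mul_star (M : ℕ) (k : Fin M) :
    ruEigenvalue M k * star (ruEigenvalue M k) = 1 := by
  have hM : M ≠ 0 := by have := k.2; omega
  have h : ‖ruEigenvalue M k‖ = 1 := by
    rw [ruEigenvalue_eq_pow, norm_pow, (Complex.isPrimitiveRoot_exp M hM).norm'_eq_one hM, one_pow]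
  rw [Complex.star_def, Complex.mul_conj, Complex.normSq_eq_norm_sq, h]
  norm_num

theorem ruEigenvalue_mul_star_eq_one_iff {M : ℕ} (i j : Fin M) :
    ruEigenvalue M i * star (ruEigenvalue M j) = 1 ↔ i = j := by
  refine ⟨fun h => ruEigenvalue_injective M ?_, fun h => h ▸ ruEigenvalue_mul_star M i⟩
  have hj := ruEigenvalue_mul_star M j
  have hne : star (ruEigenvalue M j) ≠ 0 := right_ne_zero_of_mul_eq_one hj
  exact mul_right_cancel₀ hne (h.trans hj.symm)

/-- The block-diagonality of `σ` with respect to the standard basis of the first factor, as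
invariance under conjugation by the diagonal Root-of-Unity unitary. -/
theorem eq_conjA_diagonal_iff {M N : ℕ} (σ : Matrix (Fin M × Fin N) (Fin M × Fin N) ℂ) :
    σ = conjA (diagonal (ruEigenvalue M)) σ ↔ ∀ p q, p.1 ≠ q.1 → σ p q = 0 := by
  have key : ∀ p q, conjA (diagonal (ruEigenvalue M)) σ p q =
      ruEigenvalue M p.1 * star (ruEigenvalue M q.1) * σ p q := by
    intro p q
    rw [conjA, ← diagonal_one, diagonal_kronecker_diagonal, diagonal_conjTranspose,
      mul_diagonal, diagonal_mul]
    simp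
    ring
  constructor
  · intro h p q hpq
    have h1 := congrFun (congrFun h p) q
    rw [key] at h1
    by_contra h0
    exact hpq ((ruEigenvalue_mul_star_eq_one_iff _ _).1
      (mul_right_cancel₀ h0 (h1.symm.trans (one_mul _).symm)))
  · intro h
    ext p q
    rw [key]
    by_cases hpq : p.1 = q.1
    · rw [(ruEigenvalue_mul_star_eq_one_iff _ _).2 hpq, one_mul]
    · rw [h p q hpq, mul_zero]

/-- The block-diagonality of `σ` with respect to the standard basis of the first factor, as
invariance under the standard projective measurement. -/
theorem eq_sum_diagonal_single_iff {M N : ℕ}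
    (σ : Matrix (Fin M × Fin N) (Fin M × Fin N) ℂ) :
    σ = ∑ j : Fin M, (diagonal (Pi.single j (1 : ℂ)) ⊗ₖ (1 : Matrix (Fin N) (Fin N) ℂ)) * σ *
        (diagonal (Pi.single j (1 : ℂ)) ⊗ₖ (1 : Matrix (Fin N) (Fin N) ℂ)) ↔
      ∀ p q, p.1 ≠ q.1 → σ p q = 0 := by
  have key : ∀ p q, (∑ j : Fin M,
      (diagonal (Pi.single j (1 : ℂ)) ⊗ₖ (1 : Matrix (Fin N) (Fin N) ℂ)) * σ *
        (diagonal (Pi.single j (1 : ℂ)) ⊗ₖ (1 : Matrix (Fin N) (Fin N) ℂ))) p q =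
      if p.1 = q.1 then σ p q else 0 := by
    intro p q
    simp only [← diagonal_one (n := Fin N), diagonal_kronecker_diagonal, Matrix.sum_apply,
      mul_diagonal, diagonal_mul, Pi.single_apply, mul_one, ite_mul, one_mul, zero_mul,
      mul_ite, mul_zero]
    simp [eq_comm]
  rw [← Matrix.ext_iff]
  simp only [key]
  refine forall₂_congr fun p q => ?_
  split_ifs with h <;> simp [h]

/-- For the measurement in the basis given by a unitary `V`, invariance of `ρ` is equivalent to
`D(ρ, U) = 0` for the Root-of-Unity unitary `U` with eigenbasis `V`. -/
theorem DU_eq_zero_iff_eq_sum {M N : ℕ} (ρ : Matrix (Fin M × Fin N) (Fin M × Fin N) ℂ)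
    {V : Matrix (Fin M) (Fin M) ℂ} (hV : V ∈ Matrix.unitaryGroup (Fin M) ℂ) :
    DU ρ (V * diagonal (ruEigenvalue M) * Vᴴ) = 0 ↔
      ρ = ∑ j : Fin M,
        ((V * diagonal (Pi.single j 1) * Vᴴ) ⊗ₖ (1 : Matrix (Fin N) (Fin N) ℂ)) * ρ *
          ((V * diagonal (Pi.single j 1) * Vᴴ) ⊗ₖ (1 : Matrix (Fin N) (Fin N) ℂ)) := by
  have hsplit : ∀ D : Matrix (Fin M) (Fin M) ℂ,
      (V * D * Vᴴ) ⊗ₖ (1 : Matrix (Fin N) (Fin N) ℂ) =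
        (V ⊗ₖ (1 : Matrix (Fin N) (Fin N) ℂ)) * (D ⊗ₖ (1 : Matrix (Fin N) (Fin N) ℂ)) *
          (V ⊗ₖ (1 : Matrix (Fin N) (Fin N) ℂ))ᴴ := by
    intro D
    rw [conjTranspose_kronecker, conjTranspose_one, ← mul_kronecker_mul, ← mul_kronecker_mul,
      one_mul, one_mul]
  have hV1 : (V ⊗ₖ (1 : Matrix (Fin N) (Fin N) ℂ))ᴴ * (V ⊗ₖ (1 : Matrix (Fin N) (Fin N) ℂ)) = 1 := by
    rw [conjTranspose_kronecker, conjTranspose_one, ← mul_kronecker_mul, one_mul,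
      ← star_eq_conjTranspose, (Matrix.mem_unitaryGroup_iff').1 hV, one_kronecker_one]
  have hV2 : (V ⊗ₖ (1 : Matrix (Fin N) (Fin N) ℂ)) * (V ⊗ₖ (1 : Matrix (Fin N) (Fin N) ℂ))ᴴ = 1 :=
    mul_eq_one_comm.1 hV1
  simp only [DU_eq_zero_iff, conjA, hsplit]
  generalize V ⊗ₖ (1 : Matrix (Fin N) (Fin N) ℂ) = W at hV1 hV2
  have hiff : ∀ τ : Matrix (Fin M × Fin N) (Fin M × Fin N) ℂ,
      ρ = W * τ * Wᴴ ↔ Wᴴ * ρ * W = τ := by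
    intro τ
    constructor
    · rintro rfl
      rw [← mul_assoc, ← mul_assoc, hV1, one_mul, mul_assoc, hV1, mul_one]
    · rintro rfl
      rw [← mul_assoc, ← mul_assoc, hV2, one_mul, mul_assoc, hV2, mul_one]
  have hconj := eq_conjA_diagonal_iff (Wᴴ * ρ * W)
  have hsum := eq_sum_diagonal_single_iff (Wᴴ * ρ * W)
  rw [← hsum, conjA, ← hiff, ← hiff, Finset.mul_sum, Finset.sum_mul] at hconj
  simpa only [conjTranspose_mul, conjTranspose_conjTranspose, mul_assoc] using hconj

/-- A complete family of nonzero orthogonal projectors, as many as the dimension, is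
simultaneously diagonalized by a unitary. -/
theorem exists_unitary_eq_of_projectors {M : ℕ} {P : Fin M → Matrix (Fin M) (Fin M) ℂ}
    (hherm : ∀ j, (P j).IsHermitian) (horth : ∀ j k, P j * P k = if j = k then P j else 0)
    (hne : ∀ j, P j ≠ 0) :
    ∃ V ∈ Matrix.unitaryGroup (Fin M) ℂ, ∀ j, P j = V * diagonal (Pi.single j 1) * Vᴴ := by
  have hv : ∀ j, ∃ v : Fin M → ℂ, P j *ᵥ v = v ∧ star v ⬝ᵥ v = 1 := by
    intro j
    obtain ⟨w, hw⟩ : ∃ w, P j *ᵥ w ≠ 0 := by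
      by_contra! h
      exact hne j (Matrix.ext_of_mulVec_single fun i => by rw [h, zero_mulVec])
    set c := star (P j *ᵥ w) ⬝ᵥ (P j *ᵥ w) with hc
    have hcpos : 0 < c := Matrix.dotProduct_star_self_pos_iff.2 hw
    obtain ⟨hre, him⟩ := Complex.lt_def.1 hcpos
    have hcre : ((c.re : ℝ) : ℂ) = c := Complex.ext (by simp) (by simpa using him)
    have hsq : ((Real.sqrt c.re : ℝ) : ℂ) * ((Real.sqrt c.re : ℝ) : ℂ) = c := by
      rw [← Complex.ofReal_mul, Real.mul_self_sqrt hre.le, hcre]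
    have hs0 : ((Real.sqrt c.re : ℝ) : ℂ) ≠ 0 := by
      intro h
      rw [h, mul_zero] at hsq
      exact hcpos.ne hsq
    refine ⟨((Real.sqrt c.re : ℝ) : ℂ)⁻¹ • (P j *ᵥ w), ?_, ?_⟩
    · rw [mulVec_smul, mulVec_mulVec, horth, if_pos rfl]
    · rw [star_smul, smul_dotProduct, dotProduct_smul, ← hc, star_inv₀, Complex.star_def,
        Complex.conj_ofReal, smul_eq_mul, smul_eq_mul]
      field_simp
      linear_combination -hsq
  choose v hPv hvv using hv
  have hPv' : ∀ k j, P k *ᵥ v j = if k = j then v j else 0 := by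
    intro k j
    rw [← hPv j, mulVec_mulVec, horth]
    split_ifs with h
    · rw [h]
    · rw [zero_mulVec]
  have hVV : (Matrix.of fun i j => v j i)ᴴ * (Matrix.of fun i j => v j i) = 1 := by
    ext i j
    have h1 : ((Matrix.of fun i j => v j i)ᴴ * (Matrix.of fun i j => v j i)) i j =
        star (v i) ⬝ᵥ v j := rfl
    rw [h1, one_apply]
    split_ifs with h
    · rw [h, hvv]
    · rw [← hPv i, star_mulVec, (hherm i).eq, ← dotProduct_mulVec, hPv', if_neg h,
        dotProduct_zero]
  refine ⟨Matrix.of fun i j => v j i, Matrix.mem_unitaryGroup_iff'.2 hVV, fun k => ?_⟩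
  have hPV : P k * (Matrix.of fun i j => v j i) =
      (Matrix.of fun i j => v j i) * diagonal (Pi.single k 1) := by
    ext i j
    have h1 : (P k * (Matrix.of fun i j => v j i)) i j = (P k *ᵥ v j) i := rfl
    rw [h1, hPv', mul_diagonal, Pi.single_apply]
    by_cases h : k = j
    · simp [h]
    · simp [h, Ne.symm h]
  rw [← hPV, mul_assoc, mul_eq_one_comm.1 hVV, mul_one]

/-- The infimum defining `D(ρ)` is attained, so `D(ρ)` vanishes exactly when some `D(ρ, U)` does. -/
theorem Dm_eq_zero_iff {M N : ℕ} (ρ : Matrix (Fin M × Fin N) (Fin M × Fin N) ℂ) :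
    Dm ρ = 0 ↔ ∃ V ∈ Matrix.unitaryGroup (Fin M) ℂ,
      DU ρ (V * diagonal (ruEigenvalue M) * Vᴴ) = 0 := by
  have hset : {d : ℝ | ∃ U, IsRU U ∧ d = DU ρ U} =
      (fun V : Matrix (Fin M) (Fin M) ℂ => DU ρ (V * diagonal (ruEigenvalue M) * Vᴴ)) ''
        (Matrix.unitaryGroup (Fin M) ℂ : Set (Matrix (Fin M) (Fin M) ℂ)) := by
    ext d
    constructor
    · rintro ⟨_, ⟨V, hV, rfl⟩, rfl⟩
      exact ⟨V, hV, rfl⟩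
    · rintro ⟨V, hV, rfl⟩
      exact ⟨_, ⟨V, hV, rfl⟩, rfl⟩
  have hcont : Continuous fun V : Matrix (Fin M) (Fin M) ℂ =>
      DU ρ (V * diagonal (ruEigenvalue M) * Vᴴ) :=
    (continuous_DU ρ).comp (by fun_prop)
  rw [Dm, hset]
  constructor
  · intro h
    obtain ⟨V, hV, hVeq⟩ := ((isCompact_unitaryGroup M).image hcont).sInf_mem
      (Set.Nonempty.image _ ⟨1, one_mem _⟩)
    exact ⟨V, hV, hVeq.trans h⟩
  · rintro ⟨V, hV, h⟩
    refine IsLeast.csInf_eq ⟨⟨V, hV, h⟩, ?_⟩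
    rintro _ ⟨W, _, rfl⟩
    exact DU_nonneg _ _

/-- `D(ρ) = 0` if and only if there is a complete family of
rank-one orthogonal projectors `{Π_j}` on `ℂ^M` with
`ρ = Σ_j (Π_j ⊗ I_N) ρ (Π_j ⊗ I_N)` (i.e. `ρ` has zero quantum discord). -/
theorem D_eq_zero_iff_zero_discord {M N : ℕ}
    (ρ : Matrix (Fin M × Fin N) (Fin M × Fin N) ℂ) (hρ : IsState ρ) :
    Dm ρ = 0 ↔
      ∃ P : Fin M → Matrix (Fin M) (Fin M) ℂ,
        (∀ j, (P j).IsHermitian) ∧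
        (∀ j k, P j * P k = if j = k then P j else 0) ∧
        (∑ j, P j = 1) ∧
        (∀ j, (P j).rank = 1) ∧
        ρ = ∑ j, (P j ⊗ₖ (1 : Matrix (Fin N) (Fin N) ℂ)) * ρ *
              (P j ⊗ₖ (1 : Matrix (Fin N) (Fin N) ℂ)) := by
  rw [Dm_eq_zero_iff]
  constructor
  · rintro ⟨V, hV, h⟩
    have hVV : Vᴴ * V = 1 := Matrix.mem_unitaryGroup_iff'.1 hV
    have hVV' : V * Vᴴ = 1 := mul_eq_one_comm.1 hVV
    have hVunit : IsUnit V.det := by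
      rw [← Matrix.isUnit_iff_isUnit_det]
      exact IsUnit.of_mul_eq_one _ hVV'
    have hVunit' : IsUnit Vᴴ.det := by
      rw [← Matrix.isUnit_iff_isUnit_det]
      exact IsUnit.of_mul_eq_one _ hVV
    refine ⟨fun j => V * diagonal (Pi.single j 1) * Vᴴ, fun j => ?_, fun j k => ?_, ?_,
      fun j => ?_, (DU_eq_zero_iff_eq_sum ρ hV).1 h⟩
    · exact isHermitian_mul_mul_conjTranspose V
        (isHermitian_diagonal_iff.2 fun i => by
          rw [Pi.single_apply]; split_ifs <;> simp [IsSelfAdjoint])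
    · calc V * diagonal (Pi.single j 1) * Vᴴ * (V * diagonal (Pi.single k 1) * Vᴴ)
          = V * (diagonal (Pi.single j 1) * (Vᴴ * V) * diagonal (Pi.single k 1)) * Vᴴ := by
            simp only [mul_assoc]
        _ = V * diagonal (fun i => (Pi.single j 1 : Fin M → ℂ) i * (Pi.single k 1 : Fin M → ℂ) i)
              * Vᴴ := by rw [hVV, mul_one, diagonal_mul_diagonal]
        _ = if j = k then V * diagonal (Pi.single j 1) * Vᴴ else 0 := by
            have hs : (fun i => (Pi.single j 1 : Fin M → ℂ) i * (Pi.single k 1 : Fin M → ℂ) i) =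
                if j = k then Pi.single j 1 else 0 := by
              ext i
              split_ifs with hjk
              · subst hjk
                simp [Pi.single_apply]
              · simp only [Pi.single_apply, Pi.zero_apply]
                grind
            rw [hs]
            split_ifs <;> simp
    · have hsum : ∑ j : Fin M, diagonal (Pi.single j (1 : ℂ)) = (1 : Matrix (Fin M) (Fin M) ℂ) := by
        ext p q
        simp [Matrix.sum_apply, diagonal_apply, one_apply, Pi.single_apply]
      rw [← Finset.sum_mul, ← Finset.mul_sum, hsum, mul_one, hVV']
    · rw [rank_mul_eq_left_of_isUnit_det _ _ hVunit', rank_mul_eq_right_of_isUnit_det _ _ hVunit,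
        rank_diagonal]
      simp [Pi.single_apply]
  · rintro ⟨P, hherm, horth, -, hrank, hρP⟩
    obtain ⟨V, hV, hPV⟩ := exists_unitary_eq_of_projectors hherm horth fun j h0 => by
      simpa [h0] using hrank j
    refine ⟨V, hV, (DU_eq_zero_iff_eq_sum ρ hV).2 ?_⟩
    simpa only [← hPV] using hρP

end
end

section
/- Let ρ be a bipartite quantum state on ℂ^M ⊗ ℂ^N. Then D(ρ) = 0 if and only if there exists an orthonormal basis {|k⟩}_{k=1}^M of ℂ^M in which ρ is block-diagonal with respect to the first factor, i.e., such that (⟨p| ⊗ I_N) ρ (|q⟩ ⊗ I_N) = 0 (as an N×N matrix) for all p ≠ q. (Equivalently, in the Fano expansion of ρ with respect to the Hermitian basis built from this basis, the coefficients of all off-diagonal generators U_{pq} = |p⟩⟨q|+|q⟩⟨p| and V_{pq} = −i|p⟩⟨q|+i|q⟩⟨p| on the A side vanish.) -/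
open Matrix Kronecker BigOperators ComplexOrder

noncomputable section

theorem isCompact_unitaryGroup_s14 (n : Type*) [Fintype n] [DecidableEq n] :
    IsCompact (unitaryGroup n ℂ : Set (Matrix n n ℂ)) := by
  refine (isCompact_univ_pi fun _ => isCompact_univ_pi fun _ =>
    isCompact_closedBall (0 : ℂ) 1).of_isClosed_subset
      (isClosed_unitary (R := Matrix n n ℂ)) fun U hU => ?_
  simpa only [Set.mem_pi, Set.mem_univ, true_imp_iff, mem_closedBall_zero_iff] using
    fun i j => entry_norm_bound_of_unitary hU i j

/-- The `M`-th root of unity `e^{2πi(k+1)/M}`, the `k`-th eigenvalue of an RU unitary. -/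
def rootOfUnity (M : ℕ) (k : Fin M) : ℂ :=
  Complex.exp (2 * Real.pi * Complex.I * (((k : ℕ) : ℂ) + 1) / (M : ℂ))

theorem rootOfUnity_eq_pow {M : ℕ} (k : Fin M) :
    rootOfUnity M k = Complex.exp (2 * Real.pi * Complex.I / M) ^ ((k : ℕ) + 1) := by
  rw [rootOfUnity, ← Complex.exp_nat_mul]
  push_cast
  ring_nf

theorem rootOfUnity_mul_star {M : ℕ} (k : Fin M) :
    rootOfUnity M k * star (rootOfUnity M k) = 1 := by
  have hM : M ≠ 0 := k.pos.ne'
  have h := (Complex.isPrimitiveRoot_exp M hM).norm'_eq_one hM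
  rw [Complex.star_def, Complex.mul_conj', rootOfUnity_eq_pow, norm_pow, h]
  simp

theorem rootOfUnity_injective (M : ℕ) : Function.Injective (rootOfUnity M) := by
  intro p q h
  have hM : M ≠ 0 := p.pos.ne'
  have hζ := Complex.isPrimitiveRoot_exp M hM
  rw [rootOfUnity_eq_pow, rootOfUnity_eq_pow, pow_succ, pow_succ] at h
  exact Fin.ext (hζ.pow_inj p.2 q.2 (mul_right_cancel₀ (hζ.ne_zero hM) h))

theorem kronecker_one_mem_unitary {M : ℕ} (N : ℕ) {V : Matrix (Fin M) (Fin M) ℂ}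
    (hV : V ∈ unitaryGroup (Fin M) ℂ) :
    (V ⊗ₖ (1 : Matrix (Fin N) (Fin N) ℂ)) ∈ unitaryGroup (Fin M × Fin N) ℂ := by
  rw [mem_unitaryGroup_iff, star_eq_conjTranspose, conjTranspose_kronecker, conjTranspose_one,
    ← mul_kronecker_mul, ← star_eq_conjTranspose, mem_unitaryGroup_iff.mp hV, one_mul,
    one_kronecker_one]

theorem conjTranspose_kronecker_one_mul_mul_apply {M N : ℕ}
    (ρ : Matrix (Fin M × Fin N) (Fin M × Fin N) ℂ) (V : Matrix (Fin M) (Fin M) ℂ)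
    (p q : Fin M) (i j : Fin N) :
    ((V ⊗ₖ (1 : Matrix (Fin N) (Fin N) ℂ))ᴴ * ρ * (V ⊗ₖ (1 : Matrix (Fin N) (Fin N) ℂ)))
      (p, i) (q, j) = ∑ k, ∑ l, (starRingEnd ℂ) (V k p) * ρ (k, i) (l, j) * V l q := by
  rw [Finset.sum_comm]
  simp [mul_apply, Fintype.sum_prod_type, one_apply, Finset.sum_mul, apply_ite]

theorem eq_conjA_conj_diagonal_iff {M N : ℕ} (ρ : Matrix (Fin M × Fin N) (Fin M × Fin N) ℂ)
    {V : Matrix (Fin M) (Fin M) ℂ} (hV : V ∈ unitaryGroup (Fin M) ℂ) {d : Fin M → ℂ}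
    (hd : ∀ k, d k * star (d k) = 1) (hinj : Function.Injective d) :
    ρ = conjA (V * diagonal d * Vᴴ) ρ ↔ ∀ p q, p ≠ q → ∀ i j : Fin N,
      ∑ k, ∑ l, (starRingEnd ℂ) (V k p) * ρ (k, i) (l, j) * V l q = 0 := by
  simp only [← conjTranspose_kronecker_one_mul_mul_apply]
  have hW := kronecker_one_mem_unitary N hV
  have hE : conjA (V * diagonal d * Vᴴ) ρ =
      (V ⊗ₖ (1 : Matrix (Fin N) (Fin N) ℂ)) * (diagonal (fun x : Fin M × Fin N => d x.1) *
        ((V ⊗ₖ (1 : Matrix (Fin N) (Fin N) ℂ))ᴴ * ρ * (V ⊗ₖ (1 : Matrix (Fin N) (Fin N) ℂ))) *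
        diagonal (fun x : Fin M × Fin N => star (d x.1))) *
        (V ⊗ₖ (1 : Matrix (Fin N) (Fin N) ℂ))ᴴ := by
    have h : (V * diagonal d * Vᴴ) ⊗ₖ (1 : Matrix (Fin N) (Fin N) ℂ) =
        (V ⊗ₖ (1 : Matrix (Fin N) (Fin N) ℂ)) * diagonal (fun x : Fin M × Fin N => d x.1) *
          (V ⊗ₖ (1 : Matrix (Fin N) (Fin N) ℂ))ᴴ := by
      have hdiag : diagonal (fun x : Fin M × Fin N => d x.1) =
          diagonal d ⊗ₖ (1 : Matrix (Fin N) (Fin N) ℂ) := by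
        rw [← diagonal_one, diagonal_kronecker_diagonal]
        simp
      rw [hdiag, conjTranspose_kronecker, conjTranspose_one, ← mul_kronecker_mul,
        ← mul_kronecker_mul, one_mul, one_mul]
    rw [conjA, h]
    simp only [conjTranspose_mul, conjTranspose_conjTranspose, diagonal_conjTranspose, mul_assoc]
    rfl
  rw [hE]
  generalize V ⊗ₖ (1 : Matrix (Fin N) (Fin N) ℂ) = W at hW
  have h₁ : W * Wᴴ = 1 := mem_unitaryGroup_iff.mp hW
  have h₂ : Wᴴ * W = 1 := mem_unitaryGroup_iff'.mp hW
  have hρ : ρ = W * (Wᴴ * ρ * W) * Wᴴ := by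
    simp only [mul_assoc, h₁, mul_one]
    rw [← mul_assoc, h₁, one_mul]
  generalize Wᴴ * ρ * W = σ at hρ
  have hcancel : ∀ {A B : Matrix (Fin M × Fin N) (Fin M × Fin N) ℂ},
      W * A * Wᴴ = W * B * Wᴴ ↔ A = B := by
    refine fun {A B} => ⟨fun h => ?_, fun h => h ▸ rfl⟩
    have h' := congrArg (fun X => Wᴴ * X * W) h
    simpa only [mul_assoc, h₂, mul_one, ← mul_assoc Wᴴ W, one_mul] using h'
  rw [hρ, hcancel]
  constructor
  · intro h p q hpq i j
    have hσ := congrFun₂ h (p, i) (q, j)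
    rw [mul_diagonal, diagonal_mul] at hσ
    by_contra h0
    refine hpq (hinj ?_)
    have h1 : d p * star (d q) = 1 := mul_right_cancel₀ h0 (by linear_combination -hσ)
    linear_combination d q * h1 - d p * hd q
  · intro h
    ext ⟨p, i⟩ ⟨q, j⟩
    rw [mul_diagonal, diagonal_mul]
    rcases eq_or_ne p q with rfl | hpq
    · linear_combination -σ (p, i) (p, j) * hd p
    · simp [h p q hpq i j]

theorem Dm_eq_zero_iff_exists_isRU {M N : ℕ} (ρ : Matrix (Fin M × Fin N) (Fin M × Fin N) ℂ) :
    Dm ρ = 0 ↔ ∃ U, IsRU U ∧ DU ρ U = 0 := by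
  have hset : {d : ℝ | ∃ U, IsRU U ∧ d = DU ρ U} =
      Set.image (fun V : Matrix (Fin M) (Fin M) ℂ => DU ρ (V * diagonal (rootOfUnity M) * Vᴴ))
        (unitaryGroup (Fin M) ℂ : Set (Matrix (Fin M) (Fin M) ℂ)) := by
    ext d
    constructor
    · rintro ⟨U, ⟨V, hV, rfl⟩, rfl⟩
      exact ⟨V, hV, rfl⟩
    · rintro ⟨V, hV, rfl⟩
      exact ⟨_, ⟨V, hV, rfl⟩, rfl⟩
  have hcont : Continuous fun V : Matrix (Fin M) (Fin M) ℂ =>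
      DU ρ (V * diagonal (rootOfUnity M) * Vᴴ) :=
    (continuous_DU ρ).comp
      ((continuous_id.mul continuous_const).mul continuous_id.matrix_conjTranspose)
  have hmem : Dm ρ ∈ {d : ℝ | ∃ U, IsRU U ∧ d = DU ρ U} := by
    have hcompact := (isCompact_unitaryGroup_s14 (Fin M)).image hcont
    rw [← hset] at hcompact
    exact hcompact.sInf_mem (hset ▸ Set.Nonempty.image _ ⟨1, one_mem (unitaryGroup (Fin M) ℂ)⟩)
  constructor
  · intro h
    obtain ⟨U, hU, hd⟩ := hmem
    exact ⟨U, hU, hd.symm.trans h⟩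
  · rintro ⟨U, hU, h⟩
    have hnonneg : ∀ d ∈ {d : ℝ | ∃ U, IsRU U ∧ d = DU ρ U}, 0 ≤ d := by
      rintro d ⟨U, -, rfl⟩
      exact DU_nonneg ρ U
    exact le_antisymm (csInf_le ⟨0, hnonneg⟩ ⟨U, hU, h.symm⟩) (Real.sInf_nonneg hnonneg)

theorem transpose_mem_unitaryGroup_iff_orthonormal {M : ℕ} (e : Fin M → Fin M → ℂ) :
    (of e)ᵀ ∈ unitaryGroup (Fin M) ℂ ↔
      ∀ k l, dotProduct (star (e k)) (e l) = if k = l then 1 else 0 := by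
  rw [mem_unitaryGroup_iff', ← ext_iff]
  rfl

/-- `D(ρ) = 0` if and only if there is an orthonormal basis
`{|k⟩}` of `ℂ^M` in which `ρ` is block-diagonal with respect to the first factor:
`(⟨p| ⊗ I_N) ρ (|q⟩ ⊗ I_N) = 0` for all `p ≠ q`. -/
theorem D_eq_zero_iff_block_diagonal {M N : ℕ}
    (ρ : Matrix (Fin M × Fin N) (Fin M × Fin N) ℂ) (hρ : IsState ρ) :
    Dm ρ = 0 ↔
      ∃ e : Fin M → Fin M → ℂ,
        (∀ k l, dotProduct (star (e k)) (e l) = if k = l then 1 else 0) ∧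
        ∀ p q, p ≠ q → ∀ i j : Fin N,
          (∑ k, ∑ l, (starRingEnd ℂ) (e p k) * ρ (k, i) (l, j) * e q l) = 0 := by
  rw [Dm_eq_zero_iff_exists_isRU]
  constructor
  · rintro ⟨_, ⟨V, hV, rfl⟩, h⟩
    exact ⟨Vᵀ, (transpose_mem_unitaryGroup_iff_orthonormal Vᵀ).mp hV,
      (eq_conjA_conj_diagonal_iff ρ hV rootOfUnity_mul_star (rootOfUnity_injective M)).mp
        ((DU_eq_zero_iff ρ _).mp h)⟩
  · rintro ⟨e, he, h⟩
    have hV := (transpose_mem_unitaryGroup_iff_orthonormal e).mpr he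
    exact ⟨_, ⟨_, hV, rfl⟩, (DU_eq_zero_iff ρ _).mpr
      ((eq_conjA_conj_diagonal_iff ρ hV rootOfUnity_mul_star (rootOfUnity_injective M)).mpr h)⟩

end
end
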